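/- The Dirichlet density of the set 𝒫 equals 1/6; that is, the ratio (∑_{p ∈ 𝒫} p^{−s}) / (∑_{p prime} p^{−s}) tends to 1/6 as the real number s tends to 1 from the right. -/

import Mathlib

open Filter Topology Asymptotics

namespace DirichletSeries

lemma summable_two_mul_pow {c : ℕ → ℝ} {q : ℝ} (hc : ∀ e, |c e| ≤ 2 ^ e) (hq : 0 < q)
    (hq2 : q < 1 / 2) : Summable fun e ↦ c e * q ^ e := by
  refine Summable.of_norm_bounded (g := fun e ↦ (2 * q) ^ e)
    (summable_geometric_of_lt_one (by positivity) (by linarith)) fun e ↦ ?_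
  rw [norm_mul, Real.norm_eq_abs, norm_pow, Real.norm_of_nonneg hq.le, mul_pow]
  exact mul_le_mul_of_nonneg_right (hc e) (by positivity)

lemma abs_log_tsum_sub_le {c : ℕ → ℝ} {q : ℝ} (hc0 : c 0 = 1) (hc : ∀ e, |c e| ≤ 2 ^ e)
    (hq : 0 < q) (hq5 : q ≤ 1 / 5) :
    0 < ∑' e, c e * q ^ e ∧ |Real.log (∑' e, c e * q ^ e) - c 1 * q| ≤ 50 * q ^ 2 := by
  have hs := summable_two_mul_pow hc hq (by linarith)
  set r := ∑' e, c (e + 2) * q ^ (e + 2) with hr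
  have hA : ∑' e, c e * q ^ e = 1 + (c 1 * q + r) := by
    rw [← hs.sum_add_tsum_nat_add 2, Finset.sum_range_succ, Finset.sum_range_one, hc0]
    ring
  have hr1 : |r| ≤ 20 / 3 * q ^ 2 := by
    have hg : HasSum (fun e : ℕ ↦ 4 * q ^ 2 * (2 * q) ^ e) (4 * q ^ 2 * (1 - 2 * q)⁻¹) :=
      (hasSum_geometric_of_lt_one (by positivity) (by linarith)).mul_left _
    have h1 : ‖r‖ ≤ 4 * q ^ 2 * (1 - 2 * q)⁻¹ := by
      refine tsum_of_norm_bounded hg fun e ↦ ?_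
      rw [norm_mul, Real.norm_eq_abs, norm_pow, Real.norm_of_nonneg hq.le]
      calc _ ≤ 2 ^ (e + 2) * q ^ (e + 2) := mul_le_mul_of_nonneg_right (hc _) (by positivity)
        _ = _ := by ring
    have h2 : (1 - 2 * q)⁻¹ ≤ 5 / 3 := by
      rw [inv_le_comm₀ (by linarith) (by norm_num)]
      linarith
    calc |r| ≤ _ := h1
      _ ≤ 4 * q ^ 2 * (5 / 3) := by gcongr
      _ = _ := by ring
  have hc1 : |c 1 * q| ≤ 2 * q := by
    rw [abs_mul, abs_of_pos hq]
    exact mul_le_mul_of_nonneg_right (by simpa using hc 1) hq.le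
  set t := c 1 * q + r
  have ht : |t| ≤ 10 / 3 * q := by
    have h1 : |t| ≤ _ := abs_add_le _ _
    nlinarith
  have ht2 : |t| ≤ 2 / 3 := by linarith
  rw [hA]
  refine ⟨by linarith [neg_abs_le t], ?_⟩
  have hlog : |Real.log (1 + t) - t| ≤ 3 * t ^ 2 := by
    have h1 := Real.abs_log_sub_add_sum_range_le (x := -t) (by rw [abs_neg]; linarith) 1
    simp only [Finset.sum_range_one, abs_neg, sub_neg_eq_add] at h1
    have h2 : |Real.log (1 + t) - t| ≤ |t| ^ 2 / (1 - |t|) := by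
      convert h1 using 2
      simp
      ring
    refine h2.trans ?_
    rw [div_le_iff₀ (by linarith), sq_abs]
    nlinarith [sq_nonneg t]
  have ht3 : t ^ 2 ≤ (10 / 3 * q) ^ 2 := by
    rw [← sq_abs t]
    gcongr
  calc |Real.log (1 + t) - c 1 * q| = |(Real.log (1 + t) - t) + r| := by congr 1; ring
    _ ≤ |Real.log (1 + t) - t| + |r| := abs_add_le _ _
    _ ≤ 50 * q ^ 2 := by nlinarith [sq_nonneg q]

lemma abs_log_tsum_sub_le_two {c : ℕ → ℝ} {q : ℝ} (hc0 : c 0 = 1) (hc : ∀ e, 0 ≤ c e)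
    (hq : 0 < q) (hs : Summable fun e ↦ c e * q ^ e) (hle : ∑' e, c e * q ^ e ≤ 3) :
    0 < ∑' e, c e * q ^ e ∧ |Real.log (∑' e, c e * q ^ e) - c 1 * q| ≤ 2 := by
  have h01 : c 0 * q ^ 0 + c 1 * q ^ 1 ≤ ∑' e, c e * q ^ e := by
    have := hs.sum_le_tsum (Finset.range 2) fun e _ ↦ mul_nonneg (hc e) (by positivity)
    simpa [Finset.sum_range_succ] using this
  rw [hc0, pow_zero, pow_one, mul_one] at h01
  have h1 : 0 ≤ c 1 * q := mul_nonneg (hc 1) hq.le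
  have hpos : 0 < ∑' e, c e * q ^ e := by linarith
  have h2 := Real.log_le_sub_one_of_pos hpos
  have h3 := Real.log_nonneg (x := ∑' e, c e * q ^ e) (by linarith)
  exact ⟨hpos, abs_le.2 ⟨by linarith, by linarith⟩⟩

lemma tsum_le_inv_one_sub {c : ℕ → ℝ} {q b : ℝ} (hc : ∀ e, |c e| ≤ b ^ e) (hb : 0 ≤ b)
    (hq : 0 ≤ q) (hq1 : b * q < 1) :
    ∑' e, c e * q ^ e ≤ (1 - b * q)⁻¹ := by
  refine (Real.le_norm_self _).trans (tsum_of_norm_bounded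
    (hasSum_geometric_of_lt_one (by positivity) hq1) fun e ↦ ?_)
  rw [norm_mul, Real.norm_eq_abs, norm_pow, Real.norm_of_nonneg hq, mul_pow]
  exact mul_le_mul_of_nonneg_right (hc e) (by positivity)

/-- The logarithm of the Dirichlet series of a multiplicative function is, up to a bounded
quantity, given by its values at primes. -/
theorem exists_abs_log_tsum_sub_le {g : ℕ → ℝ} (h0 : g 0 = 0) (h1 : g 1 = 1)
    (hmul : ∀ {m n : ℕ}, m.Coprime n → g (m * n) = g m * g n)
    (hle : ∀ {p : ℕ}, p.Prime → ∀ e, |g (p ^ e)| ≤ 2 ^ e)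
    (h2 : ∀ e, g (2 ^ e) = 1) (h3 : ∀ e, 0 ≤ g (3 ^ e))
    (hsum : ∀ s : ℝ, 1 < s → Summable fun n : ℕ ↦ g n * (n : ℝ) ^ (-s)) :
    ∃ C : ℝ, ∀ s : ℝ, 1 < s → 0 < ∑' n : ℕ, g n * (n : ℝ) ^ (-s) ∧
      |Real.log (∑' n : ℕ, g n * (n : ℝ) ^ (-s)) -
        ∑' p : Nat.Primes, g p * ((p : ℕ) : ℝ) ^ (-s)| ≤ C := by
  have hS : Summable fun p : Nat.Primes ↦ 50 / ((p : ℕ) : ℝ) ^ 2 := by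
    have : Summable fun n : ℕ ↦ 50 * (1 / (n : ℝ) ^ 2) :=
      (Real.summable_one_div_nat_pow.2 one_lt_two).mul_left 50
    exact (this.comp_injective (Subtype.val_injective (p := Nat.Prime))).congr fun p ↦ by
      simp [div_eq_mul_inv]
  refine ⟨∑' p : Nat.Primes, 50 / ((p : ℕ) : ℝ) ^ 2, fun s hs ↦ ?_⟩
  set F : ℕ → ℝ := fun n ↦ g n * (n : ℝ) ^ (-s)
  have hF : Summable F := hsum s hs
  have hFp : ∀ p e : ℕ, F (p ^ e) = g (p ^ e) * ((p : ℝ) ^ (-s)) ^ e := by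
    intro p e
    simp only [F]
    rw [Nat.cast_pow, ← Real.rpow_natCast, ← Real.rpow_natCast, ← Real.rpow_mul (by positivity),
      ← Real.rpow_mul (by positivity), mul_comm (e : ℝ)]
  have hprod : HasProd (fun p : Nat.Primes ↦ ∑' e, F (p ^ e)) (∑' n, F n) := by
    refine EulerProduct.eulerProduct_hasProd (by simp [F, h1]) ?_ hF.norm (by simp [F, h0])
    intro m n hmn
    simp only [F]
    rw [hmul hmn, Nat.cast_mul, Real.mul_rpow (by positivity) (by positivity)]
    ring
  have key : ∀ p : Nat.Primes, 0 < ∑' e, F (p ^ e) ∧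
      |Real.log (∑' e, F (p ^ e)) - F p| ≤ 50 / ((p : ℕ) : ℝ) ^ 2 := by
    rintro ⟨p, hp⟩
    have hp2 : (2 : ℝ) ≤ p := by exact_mod_cast hp.two_le
    have hq : 0 < (p : ℝ) ^ (-s) := by positivity
    have hq1 : (p : ℝ) ^ (-s) ≤ (p : ℝ)⁻¹ := by
      rw [← Real.rpow_neg_one]
      exact Real.rpow_le_rpow_of_exponent_le (by linarith) (by linarith)
    have hc0 : g (p ^ 0) = 1 := by simpa using h1
    have hF1 : F p = g (p ^ 1) * (p : ℝ) ^ (-s) := by simp [F]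
    have hFs : Summable fun e ↦ g (p ^ e) * ((p : ℝ) ^ (-s)) ^ e := by
      have := hF.comp_injective (Nat.pow_right_injective hp.two_le)
      exact this.congr fun e ↦ hFp p e
    simp only [hFp, hF1]
    rcases lt_or_ge p 5 with h5 | h5
    · have : p = 2 ∨ p = 3 := by
        have := hp.two_le
        interval_cases p
        · exact .inl rfl
        · exact .inr rfl
        · revert hp; decide
      rcases this with rfl | rfl
      · have hle2 : ∑' e, g (2 ^ e) * (((2 : ℕ) : ℝ) ^ (-s)) ^ e ≤ 3 := by
          refine (tsum_le_inv_one_sub (c := fun e ↦ g (2 ^ e)) (b := 1)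
          (fun e ↦ by simp [h2])
            zero_le_one hq.le ?_).trans ?_
          · push_cast at hq1 ⊢; linarith
          · rw [inv_le_comm₀ (by push_cast at hq1 ⊢; linarith) (by norm_num)]
            push_cast at hq1 ⊢; linarith
        obtain ⟨ha, hb⟩ := abs_log_tsum_sub_le_two (c := fun e ↦ g (2 ^ e)) hc0
          (fun e ↦ by simp [h2])
          hq hFs hle2
        exact ⟨ha, hb.trans (by norm_num)⟩
      · have hle3 : ∑' e, g (3 ^ e) * (((3 : ℕ) : ℝ) ^ (-s)) ^ e ≤ 3 := by
          refine (tsum_le_inv_one_sub (c := fun e ↦ g (3 ^ e)) (b := 2) (hle hp)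
            zero_le_two hq.le ?_).trans ?_
          · push_cast at hq1 ⊢; linarith
          · rw [inv_le_comm₀ (by push_cast at hq1 ⊢; linarith) (by norm_num)]
            push_cast at hq1 ⊢; linarith
        obtain ⟨ha, hb⟩ := abs_log_tsum_sub_le_two (c := fun e ↦ g (3 ^ e)) hc0 h3 hq hFs hle3
        exact ⟨ha, hb.trans (by norm_num)⟩
    · have hp5 : (5 : ℝ) ≤ p := by exact_mod_cast h5
      have hq5 : (p : ℝ)⁻¹ ≤ 1 / 5 := by
        rw [one_div]
        exact inv_anti₀ (by norm_num) hp5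
      obtain ⟨ha, hb⟩ := abs_log_tsum_sub_le (c := fun e ↦ g (p ^ e)) hc0 (hle hp) hq
        (hq1.trans hq5)
      refine ⟨ha, hb.trans ?_⟩
      rw [div_eq_mul_inv, ← inv_pow]
      gcongr
  have hFP : Summable fun p : Nat.Primes ↦ F p := hF.comp_injective Subtype.val_injective
  have hd : Summable fun p : Nat.Primes ↦ Real.log (∑' e, F (p ^ e)) - F p :=
    Summable.of_norm_bounded hS fun p ↦ (key p).2
  have hlog : Summable fun p : Nat.Primes ↦ Real.log (∑' e, F (p ^ e)) := by
    simpa using hd.add hFP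
  have hexp := Real.rexp_tsum_eq_tprod (fun p ↦ (key p).1) hlog
  rw [hprod.tprod_eq] at hexp
  refine ⟨hexp ▸ Real.exp_pos _, ?_⟩
  rw [← hexp, Real.log_exp]
  change |_ - ∑' p : Nat.Primes, F p| ≤ _
  rw [← hlog.tsum_sub hFP]
  rw [← Real.norm_eq_abs]
  exact tsum_of_norm_bounded hS.hasSum fun p ↦ (key p).2

lemma tendsto_neg_log_sub_one : Tendsto (fun s : ℝ ↦ -Real.log (s - 1)) (𝓝[>] 1) atTop := by
  refine tendsto_neg_atBot_atTop.comp (Real.tendsto_log_nhdsGT_zero.comp ?_)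
  refine tendsto_nhdsWithin_iff.2 ⟨?_, ?_⟩
  · exact (Continuous.tendsto' (f := fun s : ℝ ↦ s - 1) (by fun_prop) 1 0 (sub_self 1)).mono_left
      nhdsWithin_le_nhds
  · filter_upwards [self_mem_nhdsWithin] with s hs
    simpa using hs

lemma isBigO_log_add_log {Z : ℝ → ℝ} {c C : ℝ} (hc : 0 < c)
    (h : ∀ᶠ s in 𝓝[>] 1, c ≤ (s - 1) * Z s ∧ (s - 1) * Z s ≤ C) :
    (fun s ↦ Real.log (Z s) - -Real.log (s - 1)) =O[𝓝[>] 1] fun _ ↦ (1 : ℝ) := by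
  refine IsBigO.of_bound (max (-Real.log c) (Real.log C)) ?_
  filter_upwards [h, self_mem_nhdsWithin] with s hs hs1
  rw [Set.mem_Ioi, ← sub_pos] at hs1
  have h0 : 0 < (s - 1) * Z s := hc.trans_le hs.1
  have hZ : 0 < Z s := (mul_pos_iff_of_pos_left hs1).1 h0
  have h1 : Real.log (Z s) - -Real.log (s - 1) = Real.log ((s - 1) * Z s) := by
    rw [Real.log_mul hs1.ne' hZ.ne']; ring
  rw [h1, norm_one, mul_one, Real.norm_eq_abs, abs_le']
  exact ⟨le_max_of_le_right (Real.log_le_log h0 hs.2),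
    le_max_of_le_left (neg_le_neg (Real.log_le_log hc hs.1))⟩

lemma tendsto_div_of_isBigO {l : Filter ℝ} {P Q T : ℝ → ℝ} {c : ℝ} (hT : Tendsto T l atTop)
    (hP : (fun s ↦ P s - T s) =O[l] fun _ ↦ (1 : ℝ))
    (hQ : (fun s ↦ Q s - c * T s) =O[l] fun _ ↦ (1 : ℝ)) :
    Tendsto (fun s ↦ Q s / P s) l (𝓝 c) := by
  have h1 : (fun _ ↦ (1 : ℝ)) =o[l] T :=
    isLittleO_const_left.2 (Or.inr (tendsto_norm_atTop_atTop.comp hT))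
  have hP' := (hP.trans_isLittleO h1).tendsto_div_nhds_zero.const_add 1
  have hQ' := (hQ.trans_isLittleO h1).tendsto_div_nhds_zero.const_add c
  have h := hQ'.div hP' (by norm_num)
  rw [add_zero, add_zero, div_one] at h
  refine h.congr' ?_
  filter_upwards [hT.eventually_gt_atTop 0] with s hs
  simp only [Pi.div_apply]
  have e1 : c + (Q s - c * T s) / T s = Q s / T s := by field_simp; ring
  have e2 : 1 + (P s - T s) / T s = P s / T s := by field_simp; ring
  rw [e1, e2, div_div_div_cancel_right₀ hs.ne']

lemma isBigO_tsum_primes :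
    (fun s : ℝ ↦ ∑' p : Nat.Primes, ((p : ℕ) : ℝ) ^ (-s) - -Real.log (s - 1)) =O[𝓝[>] 1]
      fun _ ↦ (1 : ℝ) := by
  let g : ℕ → ℝ := fun n ↦ if n = 0 then 0 else 1
  have hg (s : ℝ) (hs : 1 < s) (n : ℕ) : g n * (n : ℝ) ^ (-s) = 1 / (n : ℝ) ^ s := by
    rcases eq_or_ne n 0 with rfl | hn
    · simp [g, Real.zero_rpow (by linarith : s ≠ 0)]
    · simp [g, hn, Real.rpow_neg]
  obtain ⟨C, hC⟩ := exists_abs_log_tsum_sub_le (g := g) (by simp [g]) (by simp [g])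
    (fun {m n} _ ↦ by by_cases hm : m = 0 <;> by_cases hn : n = 0 <;> simp [g, hm, hn])
    (fun {p} hp e ↦ by simp [g, hp.ne_zero, one_le_pow₀])
    (fun e ↦ by simp [g]) (fun e ↦ by simp [g])
    (fun s hs ↦ (Real.summable_one_div_nat_rpow.2 hs).congr fun n ↦ (hg s hs n).symm)
  have h1 : ∀ᶠ s : ℝ in 𝓝[>] 1, 1 / 2 ≤ (s - 1) * ∑' n : ℕ, g n * (n : ℝ) ^ (-s) ∧
      (s - 1) * ∑' n : ℕ, g n * (n : ℝ) ^ (-s) ≤ 2 := by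
    filter_upwards [tendsto_sub_mul_tsum_nat_rpow.eventually_const_le
      (show (1 / 2 : ℝ) < 1 by norm_num), tendsto_sub_mul_tsum_nat_rpow.eventually_le_const
      (show (1 : ℝ) < 2 by norm_num), self_mem_nhdsWithin] with s h1 h2 hs
    rw [tsum_congr (hg s hs)]
    exact ⟨h1, h2⟩
  have h2 : (fun s : ℝ ↦ Real.log (∑' n : ℕ, g n * (n : ℝ) ^ (-s)) -
      ∑' p : Nat.Primes, ((p : ℕ) : ℝ) ^ (-s)) =O[𝓝[>] 1] fun _ ↦ (1 : ℝ) := by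
    refine IsBigO.of_bound C ?_
    filter_upwards [self_mem_nhdsWithin] with s hs
    have h := (hC s hs).2
    rw [tsum_congr (g := fun p : Nat.Primes ↦ ((p : ℕ) : ℝ) ^ (-s))
      fun p ↦ by simp [g, p.2.ne_zero]] at h
    simpa using h
  exact ((isBigO_log_add_log (by norm_num) h1).sub h2).congr_left fun s ↦ by ring

end DirichletSeries

/-- The monoid of ideal numbers of `ℚ(√-6)`: `⟨false, x, y⟩` stands for `x + y √-6` and
`⟨true, x, y⟩` for `x √2 + y √-3`. -/
@[ext]
structure IdealNumber where
  twist : Bool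
  x : ℤ
  y : ℤ

namespace IdealNumber

instance : Mul IdealNumber where
  mul
    | ⟨false, x, y⟩, ⟨false, u, v⟩ => ⟨false, x * u - 6 * (y * v), x * v + y * u⟩
    | ⟨false, x, y⟩, ⟨true, u, v⟩ => ⟨true, x * u - 3 * (y * v), x * v + 2 * (y * u)⟩
    | ⟨true, x, y⟩, ⟨false, u, v⟩ => ⟨true, x * u - 3 * (y * v), 2 * (x * v) + y * u⟩
    | ⟨true, x, y⟩, ⟨true, u, v⟩ => ⟨false, 2 * (x * u) - 3 * (y * v), x * v + y * u⟩

@[simp] lemma mk_ff_mul_mk_ff (x y u v : ℤ) : (⟨false, x, y⟩ * ⟨false, u, v⟩ : IdealNumber) =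
    ⟨false, x * u - 6 * (y * v), x * v + y * u⟩ := rfl

@[simp] lemma mk_ff_mul_mk_tt (x y u v : ℤ) : (⟨false, x, y⟩ * ⟨true, u, v⟩ : IdealNumber) =
    ⟨true, x * u - 3 * (y * v), x * v + 2 * (y * u)⟩ := rfl

@[simp] lemma mk_tt_mul_mk_ff (x y u v : ℤ) : (⟨true, x, y⟩ * ⟨false, u, v⟩ : IdealNumber) =
    ⟨true, x * u - 3 * (y * v), 2 * (x * v) + y * u⟩ := rfl

@[simp] lemma mk_tt_mul_mk_tt (x y u v : ℤ) : (⟨true, x, y⟩ * ⟨true, u, v⟩ : IdealNumber) =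
    ⟨false, 2 * (x * u) - 3 * (y * v), x * v + y * u⟩ := rfl

instance : One IdealNumber := ⟨⟨false, 1, 0⟩⟩

lemma one_def : (1 : IdealNumber) = ⟨false, 1, 0⟩ := rfl

instance : CommMonoid IdealNumber where
  mul_assoc := by
    rintro ⟨_ | _, x, y⟩ ⟨_ | _, u, v⟩ ⟨_ | _, a, b⟩ <;> simp <;> constructor <;> ring
  one_mul := by rintro ⟨_ | _, x, y⟩ <;> simp [one_def]
  mul_one := by rintro ⟨_ | _, x, y⟩ <;> simp [one_def]
  mul_comm := by
    rintro ⟨_ | _, x, y⟩ ⟨_ | _, u, v⟩ <;> simp <;> constructor <;> ring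

instance : HasDistribNeg IdealNumber where
  neg α := ⟨α.twist, -α.x, -α.y⟩
  neg_neg := by rintro ⟨_, x, y⟩; simp
  neg_mul := by
    rintro ⟨_ | _, x, y⟩ ⟨_ | _, u, v⟩ <;> ext <;> simp <;> ring
  mul_neg := by
    rintro ⟨_ | _, x, y⟩ ⟨_ | _, u, v⟩ <;> ext <;> simp <;> ring

@[simp] lemma neg_mk (t : Bool) (x y : ℤ) : (-⟨t, x, y⟩ : IdealNumber) = ⟨t, -x, -y⟩ := rfl

/-- The rational integer `k` as an ideal number. -/
def ofInt (k : ℤ) : IdealNumber := ⟨false, k, 0⟩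

@[simp] lemma ofInt_mul_mk (k : ℤ) (t : Bool) (x y : ℤ) :
    ofInt k * ⟨t, x, y⟩ = ⟨t, k * x, k * y⟩ := by
  cases t <;> simp [ofInt]

/-- The complex conjugate. -/
def conj (α : IdealNumber) : IdealNumber := ⟨α.twist, α.x, -α.y⟩

@[simp] lemma conj_mk (t : Bool) (x y : ℤ) : conj ⟨t, x, y⟩ = ⟨t, x, -y⟩ := rfl

@[simp] lemma conj_conj (α : IdealNumber) : conj (conj α) = α := by
  rcases α with ⟨_, _, _⟩; simp

/-- The norm of an ideal number. -/
def norm : IdealNumber → ℤ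
  | ⟨false, x, y⟩ => x ^ 2 + 6 * y ^ 2
  | ⟨true, x, y⟩ => 2 * x ^ 2 + 3 * y ^ 2

@[simp] lemma norm_ff (x y : ℤ) : norm ⟨false, x, y⟩ = x ^ 2 + 6 * y ^ 2 := rfl

@[simp] lemma norm_tt (x y : ℤ) : norm ⟨true, x, y⟩ = 2 * x ^ 2 + 3 * y ^ 2 := rfl

@[simp] lemma norm_one : norm 1 = 1 := rfl

lemma norm_mul (α β : IdealNumber) : norm (α * β) = norm α * norm β := by
  rcases α with ⟨_ | _, x, y⟩ <;> rcases β with ⟨_ | _, u, v⟩ <;> simp <;> ring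

@[simp] lemma norm_neg (α : IdealNumber) : norm (-α) = norm α := by
  rcases α with ⟨_ | _, x, y⟩ <;> simp

@[simp] lemma norm_conj (α : IdealNumber) : norm (conj α) = norm α := by
  rcases α with ⟨_ | _, x, y⟩ <;> simp

@[simp] lemma norm_ofInt (k : ℤ) : norm (ofInt k) = k ^ 2 := by simp [ofInt]

lemma mul_conj (α : IdealNumber) : α * conj α = ofInt (norm α) := by
  rcases α with ⟨_ | _, x, y⟩ <;> simp [ofInt] <;> constructor <;> ring

lemma ofInt_mul_cancel {k : ℤ} (hk : k ≠ 0) {α β : IdealNumber}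
    (h : ofInt k * α = ofInt k * β) : α = β := by
  rcases α with ⟨s, x, y⟩; rcases β with ⟨t, u, v⟩
  simpa [hk] using h

lemma mul_left_cancel_of_norm {α β γ : IdealNumber} (hα : norm α ≠ 0)
    (h : α * β = α * γ) : β = γ := by
  apply ofInt_mul_cancel hα
  rw [← mul_conj, mul_comm α, mul_assoc, mul_assoc, h]

lemma ofInt_dvd {k : ℤ} {α : IdealNumber} : ofInt k ∣ α ↔ k ∣ α.x ∧ k ∣ α.y := by
  constructor
  · rintro ⟨⟨t, x, y⟩, rfl⟩; simp
  · rcases α with ⟨t, x, y⟩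
    rintro ⟨⟨u, rfl⟩, ⟨v, rfl⟩⟩
    exact ⟨⟨t, u, v⟩, by simp⟩

lemma norm_eq_one {α : IdealNumber} (h : norm α = 1) : α = 1 ∨ α = -1 := by
  rcases α with ⟨_ | _, x, y⟩
  · simp at h
    have hy : y = 0 := by
      by_contra hy
      have : 0 < y ^ 2 := by positivity
      nlinarith [sq_nonneg x]
    subst hy
    have : x = 1 ∨ x = -1 := by simpa using h
    simpa [one_def] using this
  · exfalso
    simp at h
    have : x ^ 2 % 3 = 2 := by omega
    have h3 : x % 3 = 0 ∨ x % 3 = 1 ∨ x % 3 = 2 := by omega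
    rcases h3 with h3 | h3 | h3 <;> simp [pow_two, Int.mul_emod, h3] at this



lemma sq_dvd_of_dvd_y {p : ℕ} (hp : p.Prime) {α : IdealNumber} (h : (p : ℤ) ^ 2 ∣ norm α)
    (hy : (p : ℤ) ∣ α.y) : ofInt p ∣ α := by
  have hp' : Prime (p : ℤ) := Nat.prime_iff_prime_int.1 hp
  rw [ofInt_dvd]
  refine ⟨?_, hy⟩
  rcases α with ⟨_ | _, x, y⟩
  · obtain ⟨z, rfl⟩ : (p : ℤ) ∣ y := hy
    have : (p : ℤ) ∣ x ^ 2 := by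
      simp at h
      have h2 : (p : ℤ) ^ 2 ∣ x ^ 2 := by
        have := dvd_sub h (Dvd.intro (6 * z ^ 2) rfl : (p : ℤ) ^ 2 ∣ (p : ℤ) ^ 2 * (6 * z ^ 2))
        ring_nf at this ⊢
        exact this
      exact (dvd_pow_self _ two_ne_zero).trans h2
    exact hp'.dvd_of_dvd_pow this
  · obtain ⟨z, rfl⟩ : (p : ℤ) ∣ y := hy
    have h2 : (p : ℤ) ^ 2 ∣ 2 * x ^ 2 := by
      simp at h
      have := dvd_sub h (Dvd.intro (3 * z ^ 2) rfl : (p : ℤ) ^ 2 ∣ (p : ℤ) ^ 2 * (3 * z ^ 2))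
      ring_nf at this ⊢
      exact this
    change (p : ℤ) ∣ x
    rcases hp'.dvd_or_dvd ((dvd_pow_self _ two_ne_zero).trans h2) with h3 | h3
    · have h4 : p ∣ 2 := by exact_mod_cast h3
      obtain rfl := (Nat.prime_dvd_prime_iff_eq hp Nat.prime_two).1 h4
      have : (2 : ℤ) ∣ x ^ 2 := by push_cast at h2; omega
      exact Int.prime_two.dvd_of_dvd_pow this
    · exact hp'.dvd_of_dvd_pow h3

lemma dvd_y_mul_conj_or {p : ℕ} (hp : p.Prime) {π γ : IdealNumber} (hπ : norm π = p)
    (hγ : (p : ℤ) ∣ norm γ) : (p : ℤ) ∣ (γ * conj π).y ∨ (p : ℤ) ∣ (γ * π).y := by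
  have hp' : Prime (p : ℤ) := Nat.prime_iff_prime_int.1 hp
  apply hp'.dvd_or_dvd
  have h0 : (p : ℤ) ∣ norm π := hπ ▸ dvd_rfl
  rcases γ with ⟨_ | _, x, y⟩ <;> rcases π with ⟨_ | _, a, b⟩ <;>
    simp only [norm_ff, norm_tt] at h0 hγ <;> simp
  · have := dvd_sub (h0.mul_right (y ^ 2)) (hγ.mul_right (b ^ 2))
    ring_nf at this ⊢
    exact this
  · have := dvd_sub (h0.mul_right (2 * y ^ 2)) (hγ.mul_right (b ^ 2))
    ring_nf at this ⊢
    exact this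
  · have := dvd_sub (h0.mul_right (y ^ 2)) (hγ.mul_right (2 * b ^ 2))
    ring_nf at this ⊢
    exact this
  · have h1 := dvd_sub (h0.mul_right (y ^ 2)) (hγ.mul_right (b ^ 2))
    have h2 := dvd_sub (h0.mul_right (x ^ 2)) (hγ.mul_right (a ^ 2))
    have := dvd_add h1 h2
    ring_nf at this ⊢
    have h3 := dvd_sub (dvd_neg.2 h2) h1
    ring_nf at h3
    exact h3

lemma dvd_of_dvd_y_mul_conj {p : ℕ} (hp : p.Prime) {π γ : IdealNumber} (hπ : norm π = p)
    (hγ : (p : ℤ) ∣ norm γ) (h : (p : ℤ) ∣ (γ * conj π).y) : π ∣ γ := by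
  obtain ⟨δ, hδ⟩ := sq_dvd_of_dvd_y hp (α := γ * conj π) (by
    rw [norm_mul, norm_conj, hπ, pow_two]; exact mul_dvd_mul_right hγ _) h
  refine ⟨δ, mul_left_cancel_of_norm (α := conj π) ?_ ?_⟩
  · rw [norm_conj, hπ]; exact_mod_cast hp.ne_zero
  · rw [mul_comm, hδ, ← hπ, ← mul_conj, mul_comm π, mul_assoc]

lemma dvd_or_conj_dvd {p : ℕ} (hp : p.Prime) {π γ : IdealNumber} (hπ : norm π = p)
    (hγ : (p : ℤ) ∣ norm γ) : π ∣ γ ∨ conj π ∣ γ := by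
  refine (dvd_y_mul_conj_or hp hπ hγ).imp (dvd_of_dvd_y_mul_conj hp hπ hγ) fun h ↦
    dvd_of_dvd_y_mul_conj hp (by rwa [norm_conj]) hγ (by rwa [conj_conj])

lemma exists_small_dvd_sub {p : ℕ} (hp : p.Prime) (x y : ℤ) :
    ∃ u v : ℤ, (u ≠ 0 ∨ v ≠ 0) ∧ u ^ 2 < p ∧ v ^ 2 < p ∧ (p : ℤ) ∣ u * y - v * x := by
  have : Fact p.Prime := ⟨hp⟩
  set r := Nat.sqrt p
  have hr : r ^ 2 < p := by
    refine lt_of_le_of_ne (Nat.sqrt_le' p) fun h ↦ ?_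
    exact (Nat.Prime.prime hp).not_isSquare ⟨r, by rw [← h, pow_two]⟩
  have hlt : p < (r + 1) ^ 2 := Nat.lt_succ_sqrt' p
  obtain ⟨a, ha, b, hb, hne, hab⟩ := Finset.exists_ne_map_eq_of_card_lt_of_maps_to
    (s := Finset.range (r + 1) ×ˢ Finset.range (r + 1)) (t := (Finset.univ : Finset (ZMod p)))
    (by simpa [ZMod.card, ← pow_two] using hlt)
    (f := fun a ↦ (a.1 : ZMod p) * y - a.2 * x) (fun _ _ ↦ by simp)
  simp only [Finset.mem_product, Finset.mem_range] at ha hb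
  have key : ∀ i j : ℕ, i < r + 1 → j < r + 1 → ((i : ℤ) - j) ^ 2 < p := by
    intro i j hi hj
    have : ((i : ℤ) - j) ^ 2 ≤ (r : ℤ) ^ 2 := by
      apply sq_le_sq'
      · omega
      · omega
    have : (r : ℤ) ^ 2 < p := by exact_mod_cast hr
    omega
  refine ⟨a.1 - b.1, a.2 - b.2, ?_, key _ _ ha.1 hb.1, key _ _ ha.2 hb.2, ?_⟩
  · by_contra! h
    exact hne (Prod.ext (by omega) (by omega))
  · rw [← ZMod.intCast_zmod_eq_zero_iff_dvd]
    push_cast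
    linear_combination hab

lemma exists_norm_eq_of_sq_add_six_mul_sq {p : ℕ} (hp : p.Prime) {u v : ℤ}
    (h0 : u ≠ 0 ∨ v ≠ 0) (hu : u ^ 2 < p) (hv : v ^ 2 < p)
    (h : (p : ℤ) ∣ u ^ 2 + 6 * v ^ 2) : ∃ π : IdealNumber, norm π = p := by
  obtain ⟨k, hk⟩ := h
  have hpos : 0 < u ^ 2 + 6 * v ^ 2 := by rcases h0 with h0 | h0 <;> positivity
  have hp0 : (0 : ℤ) < p := by exact_mod_cast hp.pos
  have hk0 : 0 < k := by
    rw [hk] at hpos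
    exact pos_of_mul_pos_right hpos hp0.le
  have hk7 : k < 7 := by
    by_contra! hk7
    nlinarith
  have dvd_u : ∀ q : ℕ, q.Prime → (q : ℤ) ∣ 6 → (q : ℤ) ∣ k → (q : ℤ) ∣ u := by
    intro q hq h6 hqk
    refine (Nat.prime_iff_prime_int.1 hq).dvd_of_dvd_pow (n := 2) ?_
    have h1 : u ^ 2 = p * k - 6 * v ^ 2 := by linarith
    rw [h1]
    exact dvd_sub (hqk.mul_left _) (h6.mul_right _)
  obtain rfl | rfl | rfl | rfl | rfl | rfl :
    k = 1 ∨ k = 2 ∨ k = 3 ∨ k = 4 ∨ k = 5 ∨ k = 6 := by omega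
  · exact ⟨⟨false, u, v⟩, by simp; linarith⟩
  · obtain ⟨w, rfl⟩ := dvd_u 2 Nat.prime_two (by norm_num) (by norm_num)
    push_cast at hk
    exact ⟨⟨true, w, v⟩, by simp; nlinarith⟩
  · obtain ⟨w, rfl⟩ := dvd_u 3 Nat.prime_three (by norm_num) (by norm_num)
    push_cast at hk
    exact ⟨⟨true, v, w⟩, by simp; nlinarith⟩
  · obtain ⟨w, rfl⟩ := dvd_u 2 Nat.prime_two (by norm_num) (by norm_num)
    push_cast at hk
    obtain ⟨z, rfl⟩ : (2 : ℤ) ∣ v :=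
      Int.prime_two.dvd_of_dvd_pow (n := 2) (by ring_nf at hk; omega)
    exact ⟨⟨false, w, z⟩, by simp; nlinarith⟩
  · have h5 : Prime (5 : ℤ) := by norm_num
    have : (5 : ℤ) ∣ (u - 2 * v) * (u + 2 * v) := ⟨p - 2 * v ^ 2, by linarith⟩
    rcases h5.dvd_or_dvd this with ⟨w, hw⟩ | ⟨w, hw⟩
    · obtain rfl : u = 2 * v + 5 * w := by linarith
      exact ⟨⟨true, v + w, w⟩, by simp; nlinarith⟩
    · obtain rfl : u = -2 * v + 5 * w := by linarith
      exact ⟨⟨true, v - w, w⟩, by simp; nlinarith⟩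
  · obtain ⟨w, rfl⟩ := dvd_u 2 Nat.prime_two (by norm_num) (by norm_num)
    obtain ⟨z, hz⟩ := dvd_u 3 Nat.prime_three (by norm_num) (by norm_num)
    push_cast at hk hz
    obtain ⟨a, rfl⟩ : (3 : ℤ) ∣ w := by omega
    exact ⟨⟨false, v, a⟩, by simp; nlinarith⟩

lemma exists_norm_eq_of_dvd_norm {p : ℕ} (hp : p.Prime) {γ : IdealNumber}
    (h : (p : ℤ) ∣ norm γ) (hγ : ¬ ofInt p ∣ γ) : ∃ π : IdealNumber, norm π = p := by
  rcases eq_or_ne p 2 with rfl | hp2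
  · exact ⟨⟨true, 1, 0⟩, by simp⟩
  have hp' : Prime (p : ℤ) := Nat.prime_iff_prime_int.1 hp
  obtain ⟨x, y, hxy, hy⟩ : ∃ x y : ℤ, (p : ℤ) ∣ x ^ 2 + 6 * y ^ 2 ∧ ¬ (p : ℤ) ∣ y := by
    have hp2' : ¬ (p : ℤ) ∣ 2 := fun h ↦ hp2 <| (Nat.prime_dvd_prime_iff_eq hp Nat.prime_two).1
      (by exact_mod_cast h)
    rw [ofInt_dvd] at hγ
    rcases γ with ⟨_ | _, x, y⟩ <;> simp only [norm_ff, norm_tt] at h hγ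
    · refine ⟨x, y, h, fun hy ↦ hγ ⟨hp'.dvd_of_dvd_pow (n := 2) ?_, hy⟩⟩
      exact (dvd_add_left ((dvd_pow hy two_ne_zero).mul_left _)).1 h
    · refine ⟨2 * x, y, ?_, fun hy ↦ hγ ⟨hp'.dvd_of_dvd_pow (n := 2) ?_, hy⟩⟩
      · have := h.mul_left 2
        ring_nf at this ⊢
        exact this
      · have := (dvd_add_left ((dvd_pow hy two_ne_zero).mul_left _)).1 h
        exact (hp'.dvd_or_dvd this).resolve_left hp2'
  obtain ⟨u, v, h0, hu, hv, huv⟩ := exists_small_dvd_sub hp x y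
  refine exists_norm_eq_of_sq_add_six_mul_sq hp h0 hu hv ?_
  have h1 : (p : ℤ) ∣ y ^ 2 * (u ^ 2 + 6 * v ^ 2) := by
    have := dvd_add (huv.mul_right (u * y + v * x)) (hxy.mul_left (v ^ 2))
    ring_nf at this ⊢
    exact this
  exact (hp'.dvd_or_dvd h1).resolve_left fun h ↦ hy (hp'.dvd_of_dvd_pow h)

/-- Every ideal number whose norm is divisible by a prime `p` is divisible by an ideal number of
norm `p`, or else `p` is inert and divides it. -/
lemma exists_dvd_of_dvd_norm {p : ℕ} (hp : p.Prime) {γ : IdealNumber} (h : (p : ℤ) ∣ norm γ) :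
    (∃ π : IdealNumber, norm π = p ∧ π ∣ γ) ∨ ofInt p ∣ γ := by
  by_cases hγ : ofInt p ∣ γ
  · exact .inr hγ
  · obtain ⟨π, hπ⟩ := exists_norm_eq_of_dvd_norm hp h hγ
    rcases dvd_or_conj_dvd hp hπ h with h1 | h1
    · exact .inl ⟨π, hπ, h1⟩
    · exact .inl ⟨conj π, by rwa [norm_conj], h1⟩

/-- An ideal number of norm `m n` with `m` and `n` coprime factors accordingly. -/
lemma exists_mul_eq_of_coprime {n : ℕ} (m : ℕ) (hm : m ≠ 0) (hmn : m.Coprime n) (γ : IdealNumber)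
    (hγ : norm γ = m * n) : ∃ α β : IdealNumber, norm α = m ∧ norm β = n ∧ α * β = γ := by
  induction m using Nat.strong_induction_on generalizing γ with
  | _ m ih =>
  rcases eq_or_ne m 1 with rfl | hm1
  · exact ⟨1, γ, by simp, by simpa using hγ, one_mul γ⟩
  obtain ⟨p, hp, k, rfl⟩ := Nat.exists_prime_and_dvd hm1
  have hk0 : k ≠ 0 := right_ne_zero_of_mul hm
  have hp0 : (p : ℤ) ≠ 0 := by exact_mod_cast hp.ne_zero
  have hkn : k.Coprime n := Nat.Coprime.coprime_dvd_left (dvd_mul_left k p) hmn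
  have hlt : k < p * k := lt_mul_left (Nat.pos_of_ne_zero hk0) hp.one_lt
  push_cast at hγ
  rcases exists_dvd_of_dvd_norm hp (γ := γ) ⟨k * n, by rw [hγ]; ring⟩ with
    ⟨π, hπ, δ, rfl⟩ | ⟨δ, rfl⟩
  · rw [norm_mul, hπ, mul_assoc] at hγ
    obtain ⟨α, β, hα, hβ, rfl⟩ := ih k hlt hk0 hkn δ (mul_left_cancel₀ hp0 hγ)
    exact ⟨π * α, β, by rw [norm_mul, hπ, hα]; push_cast; ring, hβ, by rw [mul_assoc]⟩
  · rw [norm_mul, norm_ofInt, mul_assoc, pow_two, mul_assoc] at hγ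
    have h1 := mul_left_cancel₀ hp0 hγ
    have hpn : p.Coprime n := Nat.Coprime.coprime_dvd_left (dvd_mul_right p k) hmn
    have hpk : p ∣ k := by
      have : p ∣ k * n := by zify; exact ⟨_, h1.symm⟩
      exact hpn.dvd_of_dvd_mul_right this
    obtain ⟨l, rfl⟩ := hpk
    push_cast at h1
    rw [mul_assoc] at h1
    obtain ⟨α, β, hα, hβ, rfl⟩ := ih l ((Nat.le_mul_of_pos_left l hp.pos).trans_lt hlt)
      (right_ne_zero_of_mul hk0) (Nat.Coprime.coprime_dvd_left (dvd_mul_left l p) hkn) δ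
      (mul_left_cancel₀ hp0 h1)
    exact ⟨ofInt p * α, β, by rw [norm_mul, norm_ofInt, hα]; push_cast; ring, hβ, by rw [mul_assoc]⟩

lemma eq_or_eq_neg_of_mul_eq_mul {m n : ℕ} (hm : m ≠ 0) (hmn : m.Coprime n)
    {α β α' β' : IdealNumber} (hα : norm α = m) (hβ : norm β = n) (hα' : norm α' = m)
    (h : α * β = α' * β') : α' = α ∧ β' = β ∨ α' = -α ∧ β' = -β := by
  have hm0 : (m : ℤ) ≠ 0 := by exact_mod_cast hm
  have hmn' : IsCoprime (m : ℤ) n := Nat.isCoprime_iff_coprime.2 hmn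
  have h1 : ofInt n * (α' * conj α) = ofInt m * (β * conj β') := by
    have hβ' : norm β' = n := by
      have := congr_arg norm h
      rw [norm_mul, norm_mul, hα, hβ, hα'] at this
      exact (mul_left_cancel₀ hm0 this).symm
    rw [← hα, ← mul_conj, ← hβ', ← mul_conj]
    calc _ = (α' * β') * (conj α * conj β') := by ac_rfl
      _ = (α * β) * (conj α * conj β') := by rw [h]
      _ = _ := by ac_rfl
  have h2 : ofInt m ∣ α' * conj α := by
    have h3 : ofInt m ∣ ofInt n * (α' * conj α) := ⟨_, h1⟩
    generalize α' * conj α = δ at h3 ⊢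
    rcases δ with ⟨t, x, y⟩
    rw [ofInt_mul_mk, ofInt_dvd] at h3
    rw [ofInt_dvd]
    exact ⟨hmn'.dvd_of_dvd_mul_left h3.1, hmn'.dvd_of_dvd_mul_left h3.2⟩
  obtain ⟨ε, hε⟩ := h2
  have h3 : α' = α * ε := by
    apply mul_left_cancel_of_norm (α := conj α) (by rwa [norm_conj, hα])
    rw [mul_comm, hε, ← hα, ← mul_conj]
    ac_rfl
  have h4 : norm ε = 1 := by
    rw [h3, norm_mul, hα] at hα'
    exact (mul_right_inj' hm0).1 (hα'.trans (mul_one _).symm)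
  have hc : ∀ β', α * β = α * β' → β' = β := fun β' h ↦
    (mul_left_cancel_of_norm (by rwa [hα]) h).symm
  rcases norm_eq_one h4 with rfl | rfl
  · rw [mul_one] at h3
    subst h3
    exact .inl ⟨rfl, hc _ h⟩
  · rw [mul_neg, mul_one] at h3
    subst h3
    refine .inr ⟨rfl, ?_⟩
    rw [← hc (-β') (by rw [h, mul_neg, neg_mul]), neg_neg]

lemma finite_setOf_norm_eq (n : ℤ) : {γ : IdealNumber | norm γ = n}.Finite := by
  have hinj : Function.Injective fun γ : IdealNumber ↦ (γ.twist, γ.x, γ.y) := by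
    rintro ⟨_, _, _⟩ ⟨_, _, _⟩ h
    simpa using h
  refine Set.Finite.subset ((((Finset.univ : Finset Bool) ×ˢ Finset.Icc (-n) n ×ˢ
    Finset.Icc (-n) n).finite_toSet).preimage hinj.injOn) ?_
  have habs : ∀ z : ℤ, |z| ≤ z ^ 2 := fun z ↦ (Int.le_self_sq |z|).trans_eq (sq_abs z)
  rintro ⟨_ | _, x, y⟩ h <;>
    simp only [Set.mem_ofPred_eq, norm_ff, norm_tt] at h <;>
    simp only [Set.mem_preimage, SetLike.mem_coe, Finset.mem_product, Finset.mem_univ,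
      Finset.mem_Icc, true_and] <;>
    refine ⟨abs_le.1 ?_, abs_le.1 ?_⟩ <;>
    nlinarith [habs x, habs y, sq_nonneg x, sq_nonneg y]

/-- The finite set of ideal numbers of given norm. -/
noncomputable def ofNorm (n : ℕ) : Finset IdealNumber := (finite_setOf_norm_eq n).toFinset

@[simp] lemma mem_ofNorm {n : ℕ} {γ : IdealNumber} : γ ∈ ofNorm n ↔ norm γ = n := by
  simp [ofNorm]

noncomputable instance : DecidableEq IdealNumber := Classical.decEq _

lemma ne_neg_of_norm {γ : IdealNumber} (h : norm γ ≠ 0) : γ ≠ -γ := by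
  rcases γ with ⟨t, x, y⟩
  simp only [neg_mk, ne_eq, mk.injEq, true_and]
  rintro ⟨h1, h2⟩
  obtain rfl : x = 0 := by omega
  obtain rfl : y = 0 := by omega
  cases t <;> simp at h

lemma ofNorm_one : ofNorm 1 = {1, -1} := by
  ext γ
  simp only [mem_ofNorm, Nat.cast_one, Finset.mem_insert, Finset.mem_singleton]
  refine ⟨norm_eq_one, ?_⟩
  rintro (rfl | rfl) <;> simp

lemma card_ofNorm_prime_pow_le {p : ℕ} (hp : p.Prime) (e : ℕ) :
    (ofNorm (p ^ e)).card ≤ 2 * 2 ^ e := by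
  have hp0 : (p : ℤ) ≠ 0 := by exact_mod_cast hp.ne_zero
  induction e using Nat.strong_induction_on with
  | _ e ih =>
  rcases e with _ | e
  · rw [pow_zero, ofNorm_one]
    exact Finset.card_le_two
  by_cases h : ∃ π : IdealNumber, norm π = p
  · obtain ⟨π, hπ⟩ := h
    have hsub : ofNorm (p ^ (e + 1)) ⊆
        (ofNorm (p ^ e)).image (π * ·) ∪ (ofNorm (p ^ e)).image (conj π * ·) := by
      intro γ hγ
      rw [mem_ofNorm, Nat.cast_pow, pow_succ'] at hγ
      simp only [Finset.mem_union, Finset.mem_image, mem_ofNorm]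
      refine (dvd_or_conj_dvd hp hπ (γ := γ) (hγ ▸ dvd_mul_right _ _)).imp ?_ ?_
      all_goals
        rintro ⟨δ, rfl⟩
        refine ⟨δ, ?_, rfl⟩
        apply mul_left_cancel₀ hp0
        simp only [norm_mul, norm_conj, hπ] at hγ
        rw [hγ, Nat.cast_pow]
    calc _ ≤ _ := Finset.card_le_card hsub
      _ ≤ _ := Finset.card_union_le _ _
      _ ≤ (ofNorm (p ^ e)).card + (ofNorm (p ^ e)).card :=
        add_le_add Finset.card_image_le Finset.card_image_le
      _ ≤ _ := by have := ih e (by omega); rw [pow_succ]; omega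
  · have hdvd : ∀ γ ∈ ofNorm (p ^ (e + 1)), ofInt p ∣ γ := by
      intro γ hγ
      rw [mem_ofNorm, Nat.cast_pow, pow_succ'] at hγ
      rcases exists_dvd_of_dvd_norm hp (γ := γ) (hγ ▸ dvd_mul_right _ _) with ⟨π, hπ, -⟩ | h1
      · exact (h ⟨π, hπ⟩).elim
      · exact h1
    rcases e with _ | e
    · have : ofNorm (p ^ (0 + 1)) = ∅ := by
        refine Finset.eq_empty_of_forall_notMem fun γ hγ ↦ ?_
        obtain ⟨δ, rfl⟩ := hdvd γ hγ
        simp only [mem_ofNorm, norm_mul, norm_ofInt, zero_add, pow_one, pow_two, mul_assoc] at hγ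
        have h1 : (p : ℤ) * norm δ = 1 := mul_left_cancel₀ hp0 (by rw [hγ, mul_one])
        have h2 : p ∣ 1 := by zify; exact ⟨_, h1.symm⟩
        exact hp.one_lt.ne' (Nat.dvd_one.1 h2)
      rw [this, Finset.card_empty]
      exact Nat.zero_le _
    · have hsub : ofNorm (p ^ (e + 1 + 1)) ⊆ (ofNorm (p ^ e)).image (ofInt p * ·) := by
        intro γ hγ
        obtain ⟨δ, rfl⟩ := hdvd γ hγ
        simp only [Finset.mem_image, mem_ofNorm]
        refine ⟨δ, ?_, rfl⟩
        simp only [mem_ofNorm, norm_mul, norm_ofInt, Nat.cast_mul, pow_succ', pow_zero, mul_one,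
          mul_assoc] at hγ
        exact mul_left_cancel₀ hp0 (mul_left_cancel₀ hp0 hγ)
      calc _ ≤ _ := Finset.card_le_card hsub
        _ ≤ _ := Finset.card_image_le
        _ ≤ _ := ih e (by omega)
        _ ≤ _ := by gcongr <;> omega

set_option linter.unusedSimpArgs false in
/-- The multiplicative weight on ideal numbers attached to an additive character `ψ` modulo `3`:
it vanishes off the ideal numbers prime to `3`, and it is a ring class character of conductor
`3` there. -/
noncomputable def weight (ψ : AddChar (ZMod 3) ℂ) : IdealNumber →* ℂ where
  toFun
    | ⟨false, x, y⟩ => if (x : ZMod 3) = 0 then 0 else ψ (x * y)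
    | ⟨true, x, y⟩ => if (x : ZMod 3) = 0 then 0 else ψ (2 * (x * y))
  map_one' := by
    change (if ((1 : ℤ) : ZMod 3) = 0 then (0 : ℂ) else
      ψ (((1 : ℤ) : ZMod 3) * ((0 : ℤ) : ZMod 3))) = 1
    simp
  map_mul' := by
    have h6 : (6 : ZMod 3) = 0 := rfl
    have h3 : (3 : ZMod 3) = 0 := rfl
    have h20 : (2 : ZMod 3) ≠ 0 := by decide
    rintro ⟨_ | _, x, y⟩ ⟨_ | _, u, v⟩ <;>
      simp only [mk_ff_mul_mk_ff, mk_ff_mul_mk_tt, mk_tt_mul_mk_ff, mk_tt_mul_mk_tt] <;>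
      push_cast <;> simp only [h6, h3, zero_mul, sub_zero, mul_eq_zero, h20, false_or] <;>
      generalize (x : ZMod 3) = x <;> generalize (y : ZMod 3) = y <;>
      generalize (u : ZMod 3) = u <;> generalize (v : ZMod 3) = v <;>
      by_cases hx : x = 0 <;> by_cases hu : u = 0 <;> simp only [hx, hu, true_or, or_true, if_true,
        or_self, if_false, zero_mul, mul_zero] <;>
      rw [← AddChar.map_add_eq_mul] <;> congr 1 <;> revert x y u v <;> decide

lemma weight_ff (ψ : AddChar (ZMod 3) ℂ) (x y : ℤ) :
    weight ψ ⟨false, x, y⟩ = if (x : ZMod 3) = 0 then 0 else ψ (x * y) := rfl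

lemma weight_tt (ψ : AddChar (ZMod 3) ℂ) (x y : ℤ) :
    weight ψ ⟨true, x, y⟩ = if (x : ZMod 3) = 0 then 0 else ψ (2 * (x * y)) := rfl

lemma weight_neg (ψ : AddChar (ZMod 3) ℂ) (γ : IdealNumber) : weight ψ (-γ) = weight ψ γ := by
  rcases γ with ⟨_ | _, x, y⟩ <;> simp [weight_ff, weight_tt]

lemma weight_conj (ψ : AddChar (ZMod 3) ℂ) (γ : IdealNumber) :
    weight ψ (conj γ) = starRingEnd ℂ (weight ψ γ) := by
  rcases γ with ⟨_ | _, x, y⟩ <;> simp only [conj_mk, weight_ff, weight_tt] <;> split_ifs <;>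
    simp [AddChar.map_neg_eq_conj]

lemma norm_weight_le (ψ : AddChar (ZMod 3) ℂ) (γ : IdealNumber) : ‖weight ψ γ‖ ≤ 1 := by
  rcases γ with ⟨_ | _, x, y⟩ <;> simp only [weight_ff, weight_tt] <;> split_ifs <;>
    simp [AddChar.norm_apply]

/-- The Dirichlet coefficients of the `L`-function of `weight ψ`. -/
noncomputable def coeff (ψ : AddChar (ZMod 3) ℂ) (n : ℕ) : ℝ :=
  (∑ γ ∈ ofNorm n, weight ψ γ).re / 2

lemma sum_weight_eq (ψ : AddChar (ZMod 3) ℂ) (n : ℕ) :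
    ∑ γ ∈ ofNorm n, weight ψ γ = ((2 * coeff ψ n : ℝ) : ℂ) := by
  have h : starRingEnd ℂ (∑ γ ∈ ofNorm n, weight ψ γ) = ∑ γ ∈ ofNorm n, weight ψ γ := by
    rw [map_sum]
    refine Finset.sum_nbij' conj conj ?_ ?_ ?_ ?_ ?_ <;> simp [weight_conj]
  rw [coeff, mul_div_cancel₀ _ two_ne_zero]
  exact (Complex.conj_eq_iff_re.1 h).symm

lemma abs_coeff_prime_pow_le (ψ : AddChar (ZMod 3) ℂ) {p : ℕ} (hp : p.Prime) (e : ℕ) :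
    |coeff ψ (p ^ e)| ≤ 2 ^ e := by
  have h1 : ‖∑ γ ∈ ofNorm (p ^ e), weight ψ γ‖ ≤ 2 * 2 ^ e := by
    calc _ ≤ ∑ γ ∈ ofNorm (p ^ e), (1 : ℝ) := norm_sum_le_of_le _ fun γ _ ↦ norm_weight_le ψ γ
      _ = (ofNorm (p ^ e)).card := by simp
      _ ≤ _ := by exact_mod_cast card_ofNorm_prime_pow_le hp e
  have h2 := (Complex.abs_re_le_norm _).trans h1
  rw [coeff, abs_div, abs_two]
  linarith

lemma coeff_zero (ψ : AddChar (ZMod 3) ℂ) : coeff ψ 0 = 0 := by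
  rw [coeff, Finset.sum_eq_zero, Complex.zero_re, zero_div]
  rintro ⟨_ | _, x, y⟩ h <;> simp only [mem_ofNorm, norm_ff, norm_tt, Nat.cast_zero] at h
  · obtain rfl : x = 0 := by
      have : x ^ 2 = 0 := by nlinarith [sq_nonneg x, sq_nonneg y]
      simpa using this
    simp [weight_ff]
  · obtain rfl : x = 0 := by
      have : x ^ 2 = 0 := by nlinarith [sq_nonneg x, sq_nonneg y]
      simpa using this
    simp [weight_tt]

lemma coeff_one (ψ : AddChar (ZMod 3) ℂ) : coeff ψ 1 = 1 := by
  rw [coeff, ofNorm_one, Finset.sum_pair (ne_neg_of_norm (by simp)), weight_neg, map_one]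
  norm_num

lemma card_filter_mul_eq {m n : ℕ} (hm : m ≠ 0) (hmn : m.Coprime n) {γ : IdealNumber}
    (hγ : γ ∈ ofNorm (m * n)) :
    ((ofNorm m ×ˢ ofNorm n).filter fun q ↦ q.1 * q.2 = γ).card = 2 := by
  rw [mem_ofNorm, Nat.cast_mul] at hγ
  obtain ⟨α, β, hα, hβ, rfl⟩ := exists_mul_eq_of_coprime m hm hmn γ hγ
  have : ((ofNorm m ×ˢ ofNorm n).filter fun q ↦ q.1 * q.2 = α * β) = {(α, β), (-α, -β)} := by
    ext ⟨α', β'⟩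
    simp only [Finset.mem_filter, Finset.mem_product, mem_ofNorm, Finset.mem_insert,
      Finset.mem_singleton, Prod.mk.injEq]
    constructor
    · rintro ⟨⟨hα', -⟩, h⟩
      exact eq_or_eq_neg_of_mul_eq_mul hm hmn hα hβ hα' h.symm
    · rintro (⟨rfl, rfl⟩ | ⟨rfl, rfl⟩) <;> simp [hα, hβ]
  rw [this, Finset.card_pair]
  intro h
  exact ne_neg_of_norm (by rw [hα]; exact_mod_cast hm) (Prod.mk.inj h).1

lemma coeff_mul (ψ : AddChar (ZMod 3) ℂ) {m n : ℕ} (hmn : m.Coprime n) :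
    coeff ψ (m * n) = coeff ψ m * coeff ψ n := by
  rcases eq_or_ne m 0 with rfl | hm
  · simp [coeff_zero]
  have h : (∑ α ∈ ofNorm m, weight ψ α) * ∑ β ∈ ofNorm n, weight ψ β =
      2 * ∑ γ ∈ ofNorm (m * n), weight ψ γ := by
    rw [Finset.sum_mul_sum, ← Finset.sum_product',
      ← Finset.sum_fiberwise_of_maps_to (t := ofNorm (m * n)) (g := fun q ↦ q.1 * q.2),
      Finset.mul_sum]
    · refine Finset.sum_congr rfl fun γ hγ ↦ ?_
      rw [Finset.sum_congr rfl (g := fun _ ↦ weight ψ γ), Finset.sum_const,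
        card_filter_mul_eq hm hmn hγ, nsmul_eq_mul, Nat.cast_two]
      intro q hq
      rw [← map_mul, (Finset.mem_filter.1 hq).2]
    · rintro ⟨α, β⟩ h
      simp only [Finset.mem_product, mem_ofNorm] at h
      simp [norm_mul, h.1, h.2]
  rw [sum_weight_eq, sum_weight_eq, sum_weight_eq] at h
  have : 2 * coeff ψ m * (2 * coeff ψ n) = 2 * (2 * coeff ψ (m * n)) := by exact_mod_cast h
  linarith

lemma coeff_two_mul (ψ : AddChar (ZMod 3) ℂ) (n : ℕ) : coeff ψ (2 * n) = coeff ψ n := by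
  have hw : weight ψ ⟨true, 1, 0⟩ = 1 := by simp [weight_tt]
  have hn : norm ⟨true, 1, 0⟩ = (2 : ℕ) := by simp
  have himg : ofNorm (2 * n) = (ofNorm n).image (⟨true, 1, 0⟩ * ·) := by
    ext γ
    simp only [mem_ofNorm, Finset.mem_image]
    constructor
    · intro h
      rcases dvd_or_conj_dvd Nat.prime_two (γ := γ) hn ⟨n, by rw [h]; simp⟩ with
        ⟨δ, rfl⟩ | ⟨δ, rfl⟩
      all_goals
        refine ⟨δ, ?_, by simp⟩
        rw [norm_mul] at h
        simpa using h
    · rintro ⟨δ, hδ, rfl⟩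
      rw [norm_mul, hδ, hn, Nat.cast_mul]
  rw [coeff, coeff, himg, Finset.sum_image]
  · simp [hw]
  · exact fun α _ β _ h ↦ mul_left_cancel_of_norm (by simp) h

lemma coeff_two_pow (ψ : AddChar (ZMod 3) ℂ) (e : ℕ) : coeff ψ (2 ^ e) = 1 := by
  induction e with
  | zero => exact coeff_one ψ
  | succ e ih => rw [pow_succ', coeff_two_mul, ih]

lemma weight_eq_zero_of_three_dvd (ψ : AddChar (ZMod 3) ℂ) {γ : IdealNumber} (h : 3 ∣ norm γ) :
    weight ψ γ = 0 := by
  have hx : ((γ.x : ℤ) : ZMod 3) = 0 := by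
    refine (ZMod.intCast_zmod_eq_zero_iff_dvd _ 3).2 (Int.prime_three.dvd_of_dvd_pow (n := 2) ?_)
    rcases γ with ⟨_ | _, x, y⟩ <;> simp only [norm_ff, norm_tt] at h ⊢ <;> omega
  rcases γ with ⟨_ | _, x, y⟩ <;> simp_all [weight_ff, weight_tt]

lemma coeff_three_mul (ψ : AddChar (ZMod 3) ℂ) (n : ℕ) : coeff ψ (3 * n) = 0 := by
  rw [coeff, Finset.sum_eq_zero, Complex.zero_re, zero_div]
  intro γ hγ
  rw [mem_ofNorm] at hγ
  exact weight_eq_zero_of_three_dvd ψ ⟨n, by rw [hγ]; simp⟩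

lemma coeff_three_pow_nonneg (ψ : AddChar (ZMod 3) ℂ) (e : ℕ) : 0 ≤ coeff ψ (3 ^ e) := by
  rcases e with _ | e
  · simp [coeff_one]
  · rw [pow_succ', coeff_three_mul]

lemma coeff_prime (ψ : AddChar (ZMod 3) ℂ) {p : ℕ} (hp : p.Prime) (hp5 : 5 ≤ p)
    {π : IdealNumber} (hπ : norm π = p) : coeff ψ p = 2 * (weight ψ π).re := by
  have hp0 : (p : ℤ) ≠ 0 := by exact_mod_cast hp.ne_zero
  have hset : ofNorm p = {π, -π} ∪ {conj π, -conj π} := by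
    ext γ
    simp only [mem_ofNorm, Finset.mem_union, Finset.mem_insert, Finset.mem_singleton]
    constructor
    · intro h
      refine (dvd_or_conj_dvd hp (γ := γ) hπ ⟨1, by rw [h]; simp⟩).imp ?_ ?_
      all_goals
        rintro ⟨ε, rfl⟩
        have : norm ε = 1 := by
          apply mul_left_cancel₀ hp0
          rw [norm_mul] at h
          simpa [hπ] using h
        rcases norm_eq_one this with rfl | rfl <;> simp
    · rintro ((rfl | rfl) | (rfl | rfl)) <;> simp [hπ]
  have hsq : ∀ z : ℤ, (p : ℤ) ≠ z ^ 2 := fun z hz ↦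
    (Nat.prime_iff_prime_int.1 hp).not_isSquare ⟨z, by rw [hz, pow_two]⟩
  have hk : ∀ k z : ℤ, (2 ≤ k ∧ k ≤ 6) → k ≠ 5 → (p : ℤ) ≠ k * z ^ 2 := by
    intro k z hk hk5 h
    have h1 : k.toNat ∣ p := by
      zify; rw [Int.toNat_of_nonneg (by omega)]; exact ⟨_, h⟩
    rcases (Nat.dvd_prime hp).1 h1 with h1 | h1
    · omega
    · obtain rfl : p = 6 := by omega
      revert hp; decide
  have hx : π.x ≠ 0 := by
    intro hx
    rcases π with ⟨_ | _, x, y⟩ <;> obtain rfl : x = 0 := hx <;> simp at hπ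
    · exact hk 6 y (by norm_num) (by norm_num) hπ.symm
    · exact hk 3 y (by norm_num) (by norm_num) hπ.symm
  have hy : π.y ≠ 0 := by
    intro hy
    rcases π with ⟨_ | _, x, y⟩ <;> obtain rfl : y = 0 := hy <;> simp at hπ
    · exact hsq x hπ.symm
    · exact hk 2 x (by norm_num) (by norm_num) hπ.symm
  have hne : π ≠ -π := ne_neg_of_norm (by rwa [hπ])
  have hne' : conj π ≠ -conj π := ne_neg_of_norm (by rwa [norm_conj, hπ])
  have hdisj : Disjoint ({π, -π} : Finset IdealNumber) {conj π, -conj π} := by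
    rcases π with ⟨t, x, y⟩
    simp at hx hy
    simp
    omega
  rw [coeff, hset, Finset.sum_union hdisj, Finset.sum_pair hne, Finset.sum_pair hne']
  simp only [weight_neg, weight_conj, Complex.add_re, Complex.conj_re]
  ring

lemma coeff_prime_eq_zero (ψ : AddChar (ZMod 3) ℂ) {p : ℕ}
    (h : ∀ π : IdealNumber, norm π ≠ p) : coeff ψ p = 0 := by
  have : ofNorm p = ∅ := Finset.eq_empty_of_forall_notMem fun γ hγ ↦ h γ (mem_ofNorm.1 hγ)
  simp [coeff, this]

lemma re_stdAddChar_three {a : ZMod 3} (ha : a ≠ 0) :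
    (ZMod.stdAddChar a : ℂ).re = -1 / 2 := by
  have h1 : ∑ x : ZMod 3, (ZMod.stdAddChar x : ℂ) = 0 := by
    refine AddChar.sum_eq_zero_of_ne_one fun h ↦ ?_
    have : (1 : ZMod 3) = 0 := ZMod.injective_stdAddChar (by rw [h]; simp)
    exact one_ne_zero this
  have h2 : ∑ x : ZMod 3, (ZMod.stdAddChar x : ℂ) =
      ZMod.stdAddChar (0 : ZMod 3) + ZMod.stdAddChar a + ZMod.stdAddChar (-a) := by
    have : (Finset.univ : Finset (ZMod 3)) = {0, a, -a} := by revert a; decide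
    rw [this, Finset.sum_insert, Finset.sum_pair, add_assoc] <;> revert a <;> decide
  rw [h2, AddChar.map_neg_eq_conj, AddChar.map_zero_eq_one] at h1
  have h3 := congr_arg Complex.re h1
  simp only [Complex.add_re, Complex.one_re, Complex.conj_re, Complex.zero_re] at h3
  linarith

lemma exists_three_dvd_y_iff {p : ℕ} (hp : p.Prime) (hp5 : 5 ≤ p) :
    (∃ γ : IdealNumber, norm γ = p ∧ 3 ∣ γ.y) ↔
      ∃ j ∈ ({1, 4, 8} : Set ℤ), ∃ x y : ℤ, Int.gcd x y = 1 ∧ x ^ 2 + 216 * y ^ 2 = j * p := by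
  have hp' : Prime (p : ℤ) := Nat.prime_iff_prime_int.1 hp
  have hcop : ∀ a b x y : ℤ, a * x ^ 2 + b * y ^ 2 = p → IsCoprime x y := by
    intro a b x y h
    refine isCoprime_of_prime_dvd ?_ ?_
    · rintro ⟨rfl, rfl⟩
      simp at h
      omega
    · rintro q hq ⟨u, rfl⟩ ⟨v, rfl⟩
      have h1 : q * (q * (a * u ^ 2 + b * v ^ 2)) = p := by linarith
      rcases hp'.irreducible.isUnit_or_isUnit h1.symm with h2 | h2
      · exact hq.not_isUnit h2
      · exact hq.not_isUnit (isUnit_of_mul_isUnit_left h2)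
  have hodd : ¬ (2 : ℤ) ∣ p := by
    intro h
    have := (Nat.prime_dvd_prime_iff_eq Nat.prime_two hp).1 (by exact_mod_cast h)
    omega
  have hcop2 : ∀ (k : ℕ) {x y : ℤ}, ¬ 2 ∣ y → IsCoprime x y → IsCoprime (2 ^ k * x) y := by
    intro k x y hy h
    exact ((((Int.prime_two.coprime_iff_not_dvd).2 hy)).pow_left).mul_left h
  constructor
  · rintro ⟨⟨_ | _, x, y⟩, h, ⟨z, hz⟩⟩
    · obtain rfl : y = 3 * z := hz
      simp only [norm_ff] at h
      have hc := hcop 1 54 x z (by linarith)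
      by_cases h2 : 2 ∣ z
      · obtain ⟨v, rfl⟩ := h2
        refine ⟨1, by simp, x, v, ?_, by linarith⟩
        exact Int.isCoprime_iff_gcd_eq_one.1 (IsCoprime.of_mul_right_right hc)
      · refine ⟨4, by simp, 2 ^ 1 * x, z, ?_, by linarith⟩
        exact Int.isCoprime_iff_gcd_eq_one.1 (hcop2 1 h2 hc)
    · obtain rfl : y = 3 * z := hz
      simp only [norm_tt] at h
      have hc := hcop 2 27 x z (by linarith)
      refine ⟨8, by simp, 2 ^ 2 * x, z, ?_, by linarith⟩
      refine Int.isCoprime_iff_gcd_eq_one.1 (hcop2 2 ?_ hc)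
      rintro ⟨v, rfl⟩
      exact hodd ⟨x ^ 2 + 54 * v ^ 2, by linarith⟩
  · rintro ⟨j, hj, x, y, -, h⟩
    have h2 : 2 ∣ x ^ 2 → 2 ∣ x := Int.prime_two.dvd_of_dvd_pow
    rcases hj with rfl | rfl | rfl
    · exact ⟨⟨false, x, 6 * y⟩, by simp; linarith, ⟨2 * y, by simp; ring⟩⟩
    · obtain ⟨u, rfl⟩ := h2 (by omega)
      exact ⟨⟨false, u, 3 * y⟩, by simp; linarith, ⟨y, by simp⟩⟩
    · obtain ⟨u, rfl⟩ := h2 (by omega)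
      obtain ⟨v, rfl⟩ : 2 ∣ u := Int.prime_two.dvd_of_dvd_pow (n := 2) (by ring_nf at h; omega)
      exact ⟨⟨true, v, 3 * y⟩, by simp; linarith, ⟨y, by simp⟩⟩

open Classical in
/-- The indicator function of the primes in question, in terms of coefficients. -/
lemma indicator_eq {p : ℕ} (hp : p.Prime) (hp5 : 5 ≤ p) :
    (if ∃ j ∈ ({1, 4, 8} : Set ℤ), ∃ x y : ℤ, Int.gcd x y = 1 ∧ x ^ 2 + 216 * y ^ 2 = j * p
      then (1 : ℝ) else 0) = (coeff 1 p + 2 * coeff ZMod.stdAddChar p) / 6 := by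
  have hx : ∀ π : IdealNumber, norm π = p → (π.x : ZMod 3) ≠ 0 := by
    intro π hπ h0
    have h3 : (3 : ℤ) ∣ p := by
      rw [ZMod.intCast_zmod_eq_zero_iff_dvd] at h0
      obtain ⟨u, hu⟩ := h0
      rcases π with ⟨_ | _, x, y⟩ <;> obtain rfl : x = 3 * u := hu <;> simp at hπ
      · exact ⟨3 * u ^ 2 + 2 * y ^ 2, by linarith⟩
      · exact ⟨6 * u ^ 2 + y ^ 2, by linarith⟩
    have := (Nat.prime_dvd_prime_iff_eq Nat.prime_three hp).1 (by exact_mod_cast h3)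
    omega
  have hone : ∀ π : IdealNumber, norm π = p → weight 1 π = 1 := by
    intro π hπ
    have := hx π hπ
    rcases π with ⟨_ | _, x, y⟩ <;> simp_all [weight_ff, weight_tt]
  rw [← exists_three_dvd_y_iff hp hp5]
  split_ifs with h
  · obtain ⟨π, hπ, hy⟩ := h
    rw [coeff_prime _ hp hp5 hπ, coeff_prime _ hp hp5 hπ, hone π hπ]
    have h1 : weight ZMod.stdAddChar π = 1 := by
      have := hx π hπ
      have hy' := (ZMod.intCast_zmod_eq_zero_iff_dvd _ 3).2 hy
      rcases π with ⟨_ | _, x, y⟩ <;> simp_all [weight_ff, weight_tt]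
    rw [h1]
    norm_num
  · by_cases h2 : ∃ π : IdealNumber, norm π = p
    · obtain ⟨π, hπ⟩ := h2
      rw [coeff_prime _ hp hp5 hπ, coeff_prime _ hp hp5 hπ, hone π hπ]
      have h1 : (weight ZMod.stdAddChar π).re = -1 / 2 := by
        have hx' := hx π hπ
        have hy' : (π.y : ZMod 3) ≠ 0 := fun h' ↦
          h ⟨π, hπ, (ZMod.intCast_zmod_eq_zero_iff_dvd _ 3).1 h'⟩
        have h20 : (2 : ZMod 3) ≠ 0 := by decide
        rcases π with ⟨_ | _, x, y⟩
        · rw [weight_ff, if_neg hx']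
          exact re_stdAddChar_three (mul_ne_zero hx' hy')
        · rw [weight_tt, if_neg hx']
          exact re_stdAddChar_three (mul_ne_zero h20 (mul_ne_zero hx' hy'))
      rw [h1]
      norm_num
    · push Not at h2
      simp [coeff_prime_eq_zero _ h2]

lemma summable_norm_rpow {k : ℝ} (hk : 2 < k) : Summable fun v : ℤ × ℤ ↦ ‖v‖ ^ (-k) := by
  have h := (EisensteinSeries.summable_one_div_norm_rpow hk).comp_injective
    (finTwoArrowEquiv ℤ).symm.injective
  refine h.congr fun v ↦ ?_
  rcases v with ⟨a, b⟩
  simp [Prod.norm_def, EisensteinSeries.norm_eq_max_natAbs, Int.norm_eq_abs]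

lemma tsum_norm_rpow {k : ℝ} (hk : 2 < k) :
    ∑' v : ℤ × ℤ, ‖v‖ ^ (-k) = 8 * ∑' n : ℕ, 1 / (n : ℝ) ^ (k - 1) := by
  have h := (summable_norm_rpow hk).hasSum.tsum_fiberwise
    (fun v : ℤ × ℤ ↦ max v.1.natAbs v.2.natAbs)
  rw [← h.tsum_eq, ← tsum_mul_left]
  congr 1 with n
  have hset : (fun v : ℤ × ℤ ↦ max v.1.natAbs v.2.natAbs) ⁻¹' {n}
      = ((Finset.box n : Finset (ℤ × ℤ)) : Set (ℤ × ℤ)) := by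
    ext v; simp [Int.mem_box]
  rw [hset, Finset.tsum_subtype' (Finset.box n) (fun v : ℤ × ℤ ↦ ‖v‖ ^ (-k))]
  have hv : ∀ v ∈ (Finset.box n : Finset (ℤ × ℤ)), ‖v‖ ^ (-k) = (n : ℝ) ^ (-k) := by
    rintro ⟨a, b⟩ hv
    rw [Int.mem_box] at hv
    rw [← hv]
    simp [Prod.norm_def, Int.norm_eq_abs]
  rw [Finset.sum_congr rfl hv, Finset.sum_const, nsmul_eq_mul]
  rcases eq_or_ne n 0 with rfl | hn
  · rw [Nat.cast_zero, Real.zero_rpow (by linarith), Real.zero_rpow (by linarith)]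
    simp
  · rw [Int.card_box hn, one_div, ← Real.rpow_neg (by positivity), neg_sub, sub_eq_add_neg,
      Real.rpow_add (by positivity), Real.rpow_one]
    push_cast
    ring

/-- The two classes of ideal numbers. -/
def sumEquiv : (ℤ × ℤ) ⊕ (ℤ × ℤ) ≃ IdealNumber where
  toFun := Sum.elim (fun v ↦ ⟨false, v.1, v.2⟩) (fun v ↦ ⟨true, v.1, v.2⟩)
  invFun
    | ⟨false, x, y⟩ => Sum.inl (x, y)
    | ⟨true, x, y⟩ => Sum.inr (x, y)
  left_inv := by rintro (⟨x, y⟩ | ⟨x, y⟩) <;> rfl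
  right_inv := by rintro ⟨_ | _, x, y⟩ <;> rfl

lemma sq_norm_le_norm (t : Bool) (v : ℤ × ℤ) : ‖v‖ ^ 2 ≤ (norm ⟨t, v.1, v.2⟩ : ℝ) := by
  rcases v with ⟨x, y⟩
  rw [Prod.norm_def]
  rcases max_cases ‖(x, y).1‖ ‖(x, y).2‖ with ⟨h, -⟩ | ⟨h, -⟩ <;> rw [h] <;> cases t <;>
    simp only [norm_ff, norm_tt, Int.norm_eq_abs, sq_abs] <;> push_cast <;>
    nlinarith [sq_nonneg (x : ℝ), sq_nonneg (y : ℝ)]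

lemma norm_rpow_neg_le (t : Bool) (v : ℤ × ℤ) {s : ℝ} (hs : 0 < s) :
    (norm ⟨t, v.1, v.2⟩ : ℝ) ^ (-s) ≤ ‖v‖ ^ (-(2 * s)) := by
  have h := sq_norm_le_norm t v
  rcases eq_or_ne v 0 with rfl | hv
  · cases t <;> simp [Real.zero_rpow (neg_ne_zero.2 hs.ne'),
      Real.zero_rpow (neg_ne_zero.2 (mul_pos two_pos hs).ne')]
  · have hv' : 0 < ‖v‖ := norm_pos_iff.2 hv
    calc _ ≤ (‖v‖ ^ 2) ^ (-s) := Real.rpow_le_rpow_of_nonpos (by positivity) h (by linarith)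
      _ = _ := by
        rw [← Real.rpow_natCast, ← Real.rpow_mul hv'.le]
        congr 1
        push_cast; ring

lemma summable_norm_rpow_neg {s : ℝ} (hs : 1 < s) (t : Bool) :
    Summable fun v : ℤ × ℤ ↦ (norm ⟨t, v.1, v.2⟩ : ℝ) ^ (-s) :=
  (summable_norm_rpow (k := 2 * s) (by linarith)).of_nonneg_of_le
    (fun v ↦ Real.rpow_nonneg ((sq_nonneg _).trans (sq_norm_le_norm t v)) _)
    (fun v ↦ norm_rpow_neg_le t v (by linarith))

/-- The sum over one class of ideal numbers of the weights times a power of the norm. -/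
noncomputable def classSum (ψ : AddChar (ZMod 3) ℂ) (t : Bool) (s : ℝ) : ℂ :=
  ∑' v : ℤ × ℤ, weight ψ ⟨t, v.1, v.2⟩ * (((norm ⟨t, v.1, v.2⟩ : ℝ) ^ (-s) : ℝ) : ℂ)

lemma norm_weight_mul_le (ψ : AddChar (ZMod 3) ℂ) (γ : IdealNumber) {r : ℝ} (hr : 0 ≤ r) :
    ‖weight ψ γ * (r : ℂ)‖ ≤ r := by
  rw [_root_.norm_mul, Complex.norm_real, Real.norm_of_nonneg hr]
  exact mul_le_of_le_one_left hr (norm_weight_le _ _)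

lemma summable_weight (ψ : AddChar (ZMod 3) ℂ) (t : Bool) {s : ℝ} (hs : 1 < s) :
    Summable fun v : ℤ × ℤ ↦
      weight ψ ⟨t, v.1, v.2⟩ * (((norm ⟨t, v.1, v.2⟩ : ℝ) ^ (-s) : ℝ) : ℂ) := by
  refine Summable.of_norm_bounded (summable_norm_rpow_neg hs t) fun v ↦ ?_
  exact norm_weight_mul_le ψ _ (Real.rpow_nonneg ((sq_nonneg _).trans (sq_norm_le_norm t v)) _)

lemma hasSum_coeff (ψ : AddChar (ZMod 3) ℂ) {s : ℝ} (hs : 1 < s) :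
    HasSum (fun n : ℕ ↦ ((2 * (coeff ψ n * (n : ℝ) ^ (-s)) : ℝ) : ℂ))
      (classSum ψ false s + classSum ψ true s) := by
  have h1 : HasSum (fun γ : IdealNumber ↦ weight ψ γ * (((norm γ : ℝ) ^ (-s) : ℝ) : ℂ))
      (classSum ψ false s + classSum ψ true s) := by
    rw [← sumEquiv.hasSum_iff]
    exact HasSum.sum (summable_weight ψ false hs).hasSum (summable_weight ψ true hs).hasSum
  have h2 := h1.tsum_fiberwise (fun γ : IdealNumber ↦ (norm γ).toNat)
  refine h2.congr_fun fun n ↦ ?_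
  have hset : (fun γ : IdealNumber ↦ (norm γ).toNat) ⁻¹' {n} = (ofNorm n : Set IdealNumber) := by
    ext γ
    have : 0 ≤ norm γ := by
      rcases γ with ⟨_ | _, x, y⟩ <;> simp only [norm_ff, norm_tt] <;> positivity
    simp only [Set.mem_preimage, Set.mem_singleton_iff, SetLike.mem_coe, mem_ofNorm]
    omega
  rw [hset, Finset.tsum_subtype' (ofNorm n)
    (fun γ ↦ weight ψ γ * (((norm γ : ℝ) ^ (-s) : ℝ) : ℂ))]
  rw [Finset.sum_congr rfl (g := fun γ ↦ weight ψ γ * (((n : ℝ) ^ (-s) : ℝ) : ℂ)),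
    ← Finset.sum_mul, sum_weight_eq]
  · push_cast; ring
  · intro γ hγ
    rw [mem_ofNorm.1 hγ]; simp

lemma summable_coeff (ψ : AddChar (ZMod 3) ℂ) {s : ℝ} (hs : 1 < s) :
    Summable fun n : ℕ ↦ coeff ψ n * (n : ℝ) ^ (-s) := by
  have h := (hasSum_coeff ψ hs).summable
  rw [Complex.summable_ofReal] at h
  exact (summable_mul_left_iff two_ne_zero).1 h

lemma two_mul_tsum_coeff (ψ : AddChar (ZMod 3) ℂ) {s : ℝ} (hs : 1 < s) :
    ((2 * ∑' n : ℕ, coeff ψ n * (n : ℝ) ^ (-s) : ℝ) : ℂ) =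
      classSum ψ false s + classSum ψ true s := by
  rw [← (hasSum_coeff ψ hs).tsum_eq, ← Complex.ofReal_tsum, tsum_mul_left]

lemma tendsto_sub_mul_tsum_norm_rpow :
    Tendsto (fun s : ℝ ↦ (s - 1) * ∑' v : ℤ × ℤ, ‖v‖ ^ (-(2 * s))) (𝓝[>] 1) (𝓝 4) := by
  have h1 : Tendsto (fun s : ℝ ↦ 2 * s - 1) (𝓝[>] 1) (𝓝[>] 1) := by
    refine tendsto_nhdsWithin_iff.2 ⟨?_, ?_⟩
    · have : Continuous fun s : ℝ ↦ 2 * s - 1 := by fun_prop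
      have := this.tendsto 1
      norm_num at this
      exact this.mono_left nhdsWithin_le_nhds
    · filter_upwards [self_mem_nhdsWithin] with s hs
      simp only [Set.mem_Ioi] at hs ⊢
      linarith
  have h2 := (tendsto_sub_mul_tsum_nat_rpow.comp h1).const_mul 4
  rw [mul_one] at h2
  refine h2.congr' ?_
  filter_upwards [self_mem_nhdsWithin] with s hs
  simp only [Set.mem_Ioi] at hs
  rw [tsum_norm_rpow (by linarith)]
  simp only [Function.comp]
  ring

lemma norm_classSum_le (ψ : AddChar (ZMod 3) ℂ) (t : Bool) {s : ℝ} (hs : 1 < s) :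
    ‖classSum ψ t s‖ ≤ ∑' v : ℤ × ℤ, ‖v‖ ^ (-(2 * s)) := by
  refine tsum_of_norm_bounded (summable_norm_rpow (by linarith)).hasSum fun v ↦ ?_
  exact (norm_weight_mul_le ψ _ (Real.rpow_nonneg
    ((sq_nonneg _).trans (sq_norm_le_norm t v)) _)).trans (norm_rpow_neg_le t v (by linarith))

lemma tsum_coeff_one_le {s : ℝ} (hs : 1 < s) :
    ∑' n : ℕ, coeff 1 n * (n : ℝ) ^ (-s) ≤ ∑' v : ℤ × ℤ, ‖v‖ ^ (-(2 * s)) := by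
  have h := two_mul_tsum_coeff 1 hs
  have h1 := congrArg (‖·‖) h
  simp only [Complex.norm_real] at h1
  have h2 := (norm_add_le _ _).trans
    <| add_le_add (norm_classSum_le 1 false hs) (norm_classSum_le 1 true hs)
  rw [← h1] at h2
  linarith [Real.le_norm_self (2 * ∑' n : ℕ, coeff 1 n * (n : ℝ) ^ (-s))]

lemma one_le_norm_of_ne_zero {v : ℤ × ℤ} (hv : v ≠ 0) : 1 ≤ ‖v‖ := by
  rcases v with ⟨a, b⟩
  have : (1 : ℤ) ≤ max |a| |b| := by
    by_contra! h
    have ha : a = 0 := by simpa using (le_max_left |a| |b|).trans_lt h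
    have hb : b = 0 := by simpa using (le_max_right |a| |b|).trans_lt h
    exact hv (by simp [ha, hb])
  rw [Prod.norm_def]
  simp only [Int.norm_eq_abs]
  exact_mod_cast this

lemma norm_shift_le {v : ℤ × ℤ} (hv : v ≠ 0) :
    (norm ⟨false, 3 * v.1 + 1, v.2⟩ : ℝ) ≤ 22 * ‖v‖ ^ 2 := by
  have h1 := one_le_norm_of_ne_zero hv
  rcases v with ⟨a, b⟩
  have ha : |(a : ℝ)| ≤ ‖(a, b)‖ := by
    simp [Prod.norm_def, Int.norm_eq_abs]
  have hb : |(b : ℝ)| ≤ ‖(a, b)‖ := by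
    simp [Prod.norm_def, Int.norm_eq_abs]
  rw [norm_ff]
  push_cast
  set R := ‖(a, b)‖
  have h2 : (3 * (a : ℝ) + 1) ^ 2 ≤ (4 * R) ^ 2 :=
    sq_le_sq' (by linarith [neg_abs_le (a : ℝ)]) (by linarith [le_abs_self (a : ℝ)])
  have h3 : (b : ℝ) ^ 2 ≤ R ^ 2 := sq_le_sq' (by linarith [neg_abs_le (b : ℝ)])
    (by linarith [le_abs_self (b : ℝ)])
  nlinarith

lemma le_two_mul_tsum_coeff_one {s : ℝ} (hs : 1 < s) :
    (22 : ℝ) ^ (-s) * ∑' v : ℤ × ℤ, ‖v‖ ^ (-(2 * s)) ≤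
      2 * ∑' n : ℕ, coeff 1 n * (n : ℝ) ^ (-s) := by
  let w : Bool → ℤ × ℤ → ℝ := fun t v ↦
    if (v.1 : ZMod 3) = 0 then 0 else (norm ⟨t, v.1, v.2⟩ : ℝ) ^ (-s)
  have hn (t : Bool) (v : ℤ × ℤ) : 0 ≤ (norm ⟨t, v.1, v.2⟩ : ℝ) ^ (-s) :=
    Real.rpow_nonneg ((sq_nonneg _).trans (sq_norm_le_norm t v)) _
  have hw0 (t : Bool) (v : ℤ × ℤ) : 0 ≤ w t v := by
    simp only [w]; split_ifs
    exacts [le_rfl, hn t v]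
  have hw (t : Bool) : classSum 1 t s = ((∑' v, w t v : ℝ) : ℂ) := by
    rw [classSum, Complex.ofReal_tsum]
    congr 1 with v
    cases t <;> simp only [w, weight_ff, weight_tt] <;> split_ifs <;> simp
  have hws : Summable (w false) := (summable_norm_rpow_neg hs false).of_nonneg_of_le (hw0 _)
    fun v ↦ by
      simp only [w]; split_ifs
      exacts [hn false v, le_rfl]
  have h1 : 2 * ∑' n : ℕ, coeff 1 n * (n : ℝ) ^ (-s) = ∑' v, w false v + ∑' v, w true v := by
    have := two_mul_tsum_coeff 1 hs
    rw [hw, hw] at this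
    exact_mod_cast this
  have hinj : Function.Injective fun v : ℤ × ℤ ↦ (3 * v.1 + 1, v.2) := by
    rintro ⟨a, b⟩ ⟨c, d⟩ h
    simp only [Prod.mk.injEq] at h ⊢
    omega
  have h3 : (3 : ZMod 3) = 0 := rfl
  rw [h1, ← tsum_mul_left]
  calc _ ≤ ∑' v : ℤ × ℤ, w false (3 * v.1 + 1, v.2) := by
        refine ((summable_norm_rpow (by linarith)).mul_left _).tsum_le_tsum (fun v ↦ ?_)
          (hws.comp_injective hinj)
        rcases eq_or_ne v 0 with rfl | hv
        · rw [norm_zero, Real.zero_rpow (by linarith), mul_zero]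
          exact hw0 _ _
        · have hv' : 0 < ‖v‖ := norm_pos_iff.2 hv
          have hne : ((3 * v.1 + 1 : ℤ) : ZMod 3) ≠ 0 := by
            push_cast; rw [h3, zero_mul, zero_add]; exact one_ne_zero
          simp only [w, if_neg hne]
          calc _ = (22 * ‖v‖ ^ 2) ^ (-s) := by
                rw [Real.mul_rpow (by norm_num) (by positivity), ← Real.rpow_natCast ‖v‖,
                  ← Real.rpow_mul hv'.le]
                congr 2
                push_cast; ring
            _ ≤ _ := by
              refine Real.rpow_le_rpow_of_nonpos ?_ (norm_shift_le hv) (by linarith)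
              have : 0 < ‖(3 * v.1 + 1, v.2)‖ := by
                refine norm_pos_iff.2 fun h ↦ ?_
                simp only [Prod.mk_eq_zero] at h
                omega
              exact (pow_pos this 2).trans_le (sq_norm_le_norm false (3 * v.1 + 1, v.2))
    _ ≤ ∑' v, w false v := tsum_comp_le_tsum_of_inj hws (hw0 _) hinj
    _ ≤ _ := le_add_of_nonneg_right (tsum_nonneg (hw0 _))

/-- The `L`-function of the trivial character has a simple pole at `1`, in the weak sense needed. -/
lemma exists_bounds_tsum_coeff_one : ∃ c C : ℝ, 0 < c ∧ ∀ᶠ s : ℝ in 𝓝[>] 1,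
    c ≤ (s - 1) * ∑' n : ℕ, coeff 1 n * (n : ℝ) ^ (-s) ∧
      (s - 1) * ∑' n : ℕ, coeff 1 n * (n : ℝ) ^ (-s) ≤ C := by
  refine ⟨(22 : ℝ) ^ (-2 : ℝ), 5, by positivity, ?_⟩
  have h := tendsto_sub_mul_tsum_norm_rpow
  filter_upwards [self_mem_nhdsWithin, h.eventually_le_const (show (4 : ℝ) < 5 by norm_num),
    h.eventually_const_le (show (2 : ℝ) < 4 by norm_num),
    mem_nhdsWithin_of_mem_nhds (Iio_mem_nhds (show (1 : ℝ) < 2 by norm_num))] with s hs h5 h2 hs2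
  simp only [Set.mem_Ioi, Set.mem_Iio] at hs hs2
  have hs0 : 0 < s - 1 := by linarith
  refine ⟨?_, (mul_le_mul_of_nonneg_left (tsum_coeff_one_le hs) hs0.le).trans h5⟩
  have h3 := mul_le_mul_of_nonneg_left (le_two_mul_tsum_coeff_one hs) hs0.le
  have h4 : (22 : ℝ) ^ (-2 : ℝ) ≤ (22 : ℝ) ^ (-s) :=
    Real.rpow_le_rpow_of_exponent_le (by norm_num) (by linarith)
  have h6 : (0 : ℝ) < (22 : ℝ) ^ (-2 : ℝ) := by positivity
  nlinarith

lemma norm_ofReal_cpow_neg_sub_le {s : ℂ} (hs : 3 / 4 ≤ s.re) {m u v : ℝ} (hm : 1 ≤ m)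
    (hu : m ≤ u) (hv : m ≤ v) :
    ‖(u : ℂ) ^ (-s) - (v : ℂ) ^ (-s)‖ ≤ ‖s‖ * m ^ (-(7 / 4) : ℝ) * |u - v| := by
  have hs0 : s ≠ 0 := by rintro rfl; norm_num at hs
  have hd : ∀ x ∈ Set.Ici m, HasDerivWithinAt (fun x : ℝ ↦ (x : ℂ) ^ (-s))
      (-s * (x : ℂ) ^ (-s - 1)) (Set.Ici m) x := by
    intro x hx
    have hx0 : x ≠ 0 := (zero_lt_one.trans_le (hm.trans hx)).ne'
    exact (hasDerivAt_ofReal_cpow_const hx0 (neg_ne_zero.2 hs0)).hasDerivWithinAt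
  have h := Convex.norm_image_sub_le_of_norm_hasDerivWithin_le (C := ‖s‖ * m ^ (-(7 / 4) : ℝ)) hd
    (fun x hx ↦ ?_) (convex_Ici m) (Set.mem_Ici.2 hv) (Set.mem_Ici.2 hu)
  · exact h
  · have hx0 : 0 < x := zero_lt_one.trans_le (hm.trans hx)
    rw [_root_.norm_mul, _root_.norm_neg, Complex.norm_cpow_eq_rpow_re_of_pos hx0]
    refine mul_le_mul_of_nonneg_left ?_ (norm_nonneg _)
    calc x ^ (-s - 1).re ≤ x ^ (-(7 / 4) : ℝ) := by
          refine Real.rpow_le_rpow_of_exponent_le (hm.trans hx) ?_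
          simp only [Complex.sub_re, Complex.neg_re, Complex.one_re]
          linarith
      _ ≤ _ := Real.rpow_le_rpow_of_nonpos (by linarith) hx (by norm_num)

/-- The part of the `L`-function coming from three consecutive values of the second coordinate. -/
noncomputable def blockSum (ψ : AddChar (ZMod 3) ℂ) (t : Bool) (v : ℤ × ℤ) (s : ℂ) : ℂ :=
  ∑ j : Fin 3, weight ψ ⟨t, v.1, v.2 * 3 + (j : ℕ)⟩ *
    ((norm ⟨t, v.1, v.2 * 3 + (j : ℕ)⟩ : ℝ) : ℂ) ^ (-s)

lemma sum_weight_block {ψ : AddChar (ZMod 3) ℂ} (hψ : ψ ≠ 1) (t : Bool) (v : ℤ × ℤ) :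
    ∑ j : Fin 3, weight ψ ⟨t, v.1, v.2 * 3 + (j : ℕ)⟩ = 0 := by
  have h : ψ 0 + ψ 1 + ψ 2 = 0 := by
    rw [← AddChar.sum_eq_zero_of_ne_one hψ]
    exact (Fin.sum_univ_three (fun a : Fin 3 ↦ ψ a)).symm
  have h3 : (3 : ZMod 3) = 0 := rfl
  have h22 : (2 : ZMod 3) * 2 = 1 := rfl
  have h12 : (1 : ZMod 3) ≠ 0 := by decide
  have h20 : (2 : ZMod 3) ≠ 0 := by decide
  cases t <;> rw [Fin.sum_univ_three] <;> simp only [weight_ff, weight_tt] <;> push_cast <;>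
    generalize (v.1 : ZMod 3) = x <;>
    simp only [h3, mul_zero, zero_add, mul_one, Fin.val_zero, Fin.val_one, Fin.val_two,
      Nat.cast_zero, Nat.cast_one, Nat.cast_ofNat] <;>
    (obtain rfl | rfl | rfl : x = 0 ∨ x = 1 ∨ x = 2 := by revert x; decide) <;>
    simp only [if_true, h12, h20, if_false, add_zero, h22, one_mul, mul_one, mul_zero] <;>
    linear_combination h

lemma sq_norm_le_norm_block (t : Bool) {v : ℤ × ℤ} (hv : v.1 ≠ 0) (j : Fin 3) :
    ‖v‖ ^ 2 ≤ (norm ⟨t, v.1, v.2 * 3 + (j : ℕ)⟩ : ℝ) := by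
  rcases v with ⟨x, k⟩
  have hj : ((j : ℕ) : ℤ) ≤ 2 := by have := j.2; omega
  have hj0 : (0 : ℤ) ≤ ((j : ℕ) : ℤ) := Int.natCast_nonneg _
  generalize ((j : ℕ) : ℤ) = i at hj hj0 ⊢
  simp only at hv
  have hx : 1 ≤ x ^ 2 := by have := pow_pos (abs_pos.2 hv) 2; rw [sq_abs] at this; omega
  have hy : k ^ 2 ≤ x ^ 2 ∨ k ^ 2 ≤ (k * 3 + i) ^ 2 := by
    rcases eq_or_ne k 0 with rfl | hk
    · left; nlinarith
    · right
      rcases lt_or_gt_of_ne hk with h | h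
      · nlinarith
      · nlinarith
  have hZ : max (x ^ 2) (k ^ 2) ≤ norm ⟨t, x, k * 3 + i⟩ := by
    refine max_le ?_ ?_ <;> cases t <;> simp only [norm_ff, norm_tt] <;>
      rcases hy with hy | hy <;> nlinarith [sq_nonneg x, sq_nonneg (k * 3 + i)]
  have hR : ‖(x, k)‖ ^ 2 = ((max (x ^ 2) (k ^ 2) : ℤ) : ℝ) := by
    rw [Prod.norm_def, ← sq_abs x, ← sq_abs k]
    push_cast
    simp only [Int.norm_eq_abs]
    rcases le_total |(x : ℝ)| |(k : ℝ)| with h | h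
    · rw [max_eq_right h, max_eq_right (by gcongr)]
    · rw [max_eq_left h, max_eq_left (by gcongr)]
  rw [hR]
  exact_mod_cast hZ

lemma abs_norm_block_sub_le (t : Bool) {v : ℤ × ℤ} (hv : v ≠ 0) (j : Fin 3) :
    |(norm ⟨t, v.1, v.2 * 3 + (j : ℕ)⟩ : ℝ) - (norm ⟨t, v.1, v.2 * 3⟩ : ℝ)| ≤ 96 * ‖v‖ := by
  have h1 := one_le_norm_of_ne_zero hv
  rcases v with ⟨x, k⟩
  have hk : |(k : ℝ)| ≤ ‖(x, k)‖ := by simp [Prod.norm_def, Int.norm_eq_abs]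
  have hj : ((j : ℕ) : ℝ) ≤ 2 := by have := j.2; norm_cast; omega
  have hj0 : (0 : ℝ) ≤ ((j : ℕ) : ℝ) := Nat.cast_nonneg _
  have hb : |((j : ℕ) : ℝ) * (6 * k + (j : ℕ))| ≤ 16 * ‖(x, k)‖ := by
    rw [abs_mul, abs_of_nonneg hj0]
    have : |6 * (k : ℝ) + (j : ℕ)| ≤ 8 * ‖(x, k)‖ := by
      refine (abs_add_le _ _).trans ?_
      rw [abs_mul, abs_of_nonneg hj0, abs_of_nonneg (by norm_num : (0 : ℝ) ≤ 6)]
      linarith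
    calc _ ≤ 2 * (8 * ‖(x, k)‖) := by gcongr
      _ = _ := by ring
  cases t <;> simp only [norm_ff, norm_tt] <;> push_cast
  · have : ((x : ℝ) ^ 2 + 6 * (k * 3 + (j : ℕ)) ^ 2) - (x ^ 2 + 6 * (k * 3) ^ 2) =
      6 * ((j : ℕ) * (6 * k + (j : ℕ))) := by ring
    rw [this, abs_mul, abs_of_nonneg (by norm_num : (0 : ℝ) ≤ 6)]
    linarith
  · have : (2 * (x : ℝ) ^ 2 + 3 * (k * 3 + (j : ℕ)) ^ 2) - (2 * x ^ 2 + 3 * (k * 3) ^ 2) =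
      3 * ((j : ℕ) * (6 * k + (j : ℕ))) := by ring
    rw [this, abs_mul, abs_of_nonneg (by norm_num : (0 : ℝ) ≤ 3)]
    linarith

lemma weight_eq_zero_of_x {ψ : AddChar (ZMod 3) ℂ} {x : ℤ} (hx : (x : ZMod 3) = 0)
    (t : Bool) (y : ℤ) : weight ψ ⟨t, x, y⟩ = 0 := by
  cases t <;> simp [weight_ff, weight_tt, hx]

lemma differentiable_blockSum (ψ : AddChar (ZMod 3) ℂ) (t : Bool) (v : ℤ × ℤ) :
    Differentiable ℂ (blockSum ψ t v) := by
  refine Differentiable.fun_sum fun j _ ↦ ?_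
  by_cases hx : (v.1 : ZMod 3) = 0
  · simp only [weight_eq_zero_of_x hx, zero_mul]
    exact differentiable_const 0
  · have hv : v.1 ≠ 0 := fun h ↦ hx (by simp [h])
    have h1 := one_le_norm_of_ne_zero (v := v) fun h ↦ hv (by simp [h])
    have h2 := sq_norm_le_norm_block t hv j
    have h3 : ((norm ⟨t, v.1, v.2 * 3 + (j : ℕ)⟩ : ℝ) : ℂ) ≠ 0 := by
      have : (0 : ℝ) < (norm ⟨t, v.1, v.2 * 3 + (j : ℕ)⟩ : ℝ) := by nlinarith
      exact_mod_cast this.ne'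
    exact (Differentiable.const_cpow differentiable_neg (Or.inl h3)).const_mul _

lemma norm_blockSum_le {ψ : AddChar (ZMod 3) ℂ} (hψ : ψ ≠ 1) (t : Bool) (v : ℤ × ℤ) {s : ℂ}
    (hs : 3 / 4 < s.re) (hs2 : ‖s‖ < 2) : ‖blockSum ψ t v s‖ ≤ 576 * ‖v‖ ^ (-(5 / 2) : ℝ) := by
  by_cases hx : (v.1 : ZMod 3) = 0
  · simp only [blockSum, weight_eq_zero_of_x hx, zero_mul, Finset.sum_const_zero, norm_zero]
    positivity
  have hv : v.1 ≠ 0 := fun h ↦ hx (by simp [h])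
  have hv0 : v ≠ 0 := fun h ↦ hv (by simp [h])
  have h1 := one_le_norm_of_ne_zero hv0
  have hR : 0 < ‖v‖ := by linarith
  have h0 := sq_norm_le_norm_block t hv 0
  simp only [Fin.val_zero, Nat.cast_zero, add_zero] at h0
  set z : ℂ := ((norm ⟨t, v.1, v.2 * 3⟩ : ℝ) : ℂ) ^ (-s)
  have hsum : blockSum ψ t v s = ∑ j : Fin 3, weight ψ ⟨t, v.1, v.2 * 3 + (j : ℕ)⟩ *
      (((norm ⟨t, v.1, v.2 * 3 + (j : ℕ)⟩ : ℝ) : ℂ) ^ (-s) - z) := by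
    simp only [mul_sub, Finset.sum_sub_distrib, ← Finset.sum_mul, sum_weight_block hψ, zero_mul,
      sub_zero]
    rfl
  rw [hsum]
  have hterm : ∀ j ∈ (Finset.univ : Finset (Fin 3)), ‖weight ψ ⟨t, v.1, v.2 * 3 + (j : ℕ)⟩ *
      (((norm ⟨t, v.1, v.2 * 3 + (j : ℕ)⟩ : ℝ) : ℂ) ^ (-s) - z)‖ ≤
        192 * ‖v‖ ^ (-(5 / 2) : ℝ) := by
    intro j _
    rw [_root_.norm_mul]
    refine (mul_le_of_le_one_left (norm_nonneg _) (norm_weight_le _ _)).trans ?_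
    refine (norm_ofReal_cpow_neg_sub_le hs.le (one_le_pow₀ h1)
      (sq_norm_le_norm_block t hv j) h0).trans ?_
    calc _ ≤ 2 * (‖v‖ ^ 2) ^ (-(7 / 4) : ℝ) * (96 * ‖v‖) := by
          gcongr
          exact abs_norm_block_sub_le t hv0 j
      _ = 192 * ((‖v‖ ^ 2) ^ (-(7 / 4) : ℝ) * ‖v‖) := by ring
      _ = _ := by
          congr 1
          nth_rw 2 [← Real.rpow_one ‖v‖]
          rw [← Real.rpow_natCast ‖v‖, ← Real.rpow_mul hR.le, ← Real.rpow_add hR]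
          norm_num
  refine (norm_sum_le_of_le _ hterm).trans_eq ?_
  rw [Finset.sum_const, Finset.card_univ, Fintype.card_fin]
  ring

lemma classSum_eq_tsum_blockSum (ψ : AddChar (ZMod 3) ℂ) (t : Bool) {s : ℝ} (hs : 1 < s) :
    classSum ψ t s = ∑' v : ℤ × ℤ, blockSum ψ t v s := by
  let e : (ℤ × ℤ) × Fin 3 ≃ ℤ × ℤ :=
    (Equiv.prodAssoc ℤ ℤ (Fin 3)).trans ((Equiv.refl ℤ).prodCongr (Int.divModEquiv 3).symm)
  have he : ∀ v j, e (v, j) = (v.1, v.2 * 3 + ((j : ℕ) : ℤ)) := fun v j ↦ by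
    simp [e, Int.divModEquiv]
  rw [classSum, ← e.tsum_eq]
  refine (Summable.tsum_prod ((e.summable_iff).2 (summable_weight ψ t hs))).trans ?_
  congr 1 with v
  rw [tsum_fintype, blockSum]
  refine Finset.sum_congr rfl fun j _ ↦ ?_
  rw [Function.comp_apply, he, Complex.ofReal_cpow ((sq_nonneg _).trans
    (sq_norm_le_norm t (v.1, v.2 * 3 + ((j : ℕ) : ℤ))))]
  push_cast
  rfl

lemma exists_differentiableAt_classSum {ψ : AddChar (ZMod 3) ℂ} (hψ : ψ ≠ 1) (t : Bool) :
    ∃ F : ℂ → ℂ, DifferentiableAt ℂ F 1 ∧ ∀ s : ℝ, 1 < s → classSum ψ t s = F s := by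
  refine ⟨fun s ↦ ∑' v : ℤ × ℤ, blockSum ψ t v s, ?_,
    fun s hs ↦ classSum_eq_tsum_blockSum ψ t hs⟩
  have hU : IsOpen {s : ℂ | 3 / 4 < s.re ∧ ‖s‖ < 2} :=
    (isOpen_lt continuous_const Complex.continuous_re).inter
      (isOpen_lt continuous_norm continuous_const)
  refine (Complex.differentiableOn_tsum_of_summable_norm
    ((summable_norm_rpow (k := 5 / 2) (by norm_num)).mul_left 576)
    (fun v ↦ (differentiable_blockSum ψ t v).differentiableOn) hU
    fun v s hs ↦ norm_blockSum_le hψ t v hs.1 hs.2).differentiableAt (hU.mem_nhds ?_)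
  norm_num

/-- The `L`-function of a nontrivial character is Lipschitz at `1`. -/
lemma exists_abs_tsum_coeff_sub_le {ψ : AddChar (ZMod 3) ℂ} (hψ : ψ ≠ 1) :
    ∃ l K : ℝ, ∀ᶠ s : ℝ in 𝓝[>] 1,
      |∑' n : ℕ, coeff ψ n * (n : ℝ) ^ (-s) - l| ≤ K * (s - 1) := by
  obtain ⟨F, hF, hF'⟩ := exists_differentiableAt_classSum hψ false
  obtain ⟨G, hG, hG'⟩ := exists_differentiableAt_classSum hψ true
  obtain ⟨K, hK⟩ := (hF.add hG).isBigO_sub.bound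
  have hofReal : Tendsto (fun s : ℝ ↦ (s : ℂ)) (𝓝[>] 1) (𝓝 1) :=
    (Complex.continuous_ofReal.tendsto' 1 1 Complex.ofReal_one).mono_left nhdsWithin_le_nhds
  refine ⟨(F 1 + G 1).re / 2, K / 2, ?_⟩
  filter_upwards [hofReal.eventually hK, self_mem_nhdsWithin] with s hs hs1
  rw [Set.mem_Ioi] at hs1
  simp only [Pi.add_apply] at hs
  rw [← hF' s hs1, ← hG' s hs1, ← two_mul_tsum_coeff ψ hs1] at hs
  have h1 := (Complex.abs_re_le_norm _).trans hs
  have h2 : ‖(s : ℂ) - 1‖ = s - 1 := by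
    rw [← Complex.ofReal_one, ← Complex.ofReal_sub, Complex.norm_real,
      Real.norm_of_nonneg (by linarith)]
  rw [h2, Complex.sub_re, Complex.ofReal_re] at h1
  have h3 : ∑' n : ℕ, coeff ψ n * (n : ℝ) ^ (-s) - (F 1 + G 1).re / 2 =
      (2 * ∑' n : ℕ, coeff ψ n * (n : ℝ) ^ (-s) - (F 1 + G 1).re) / 2 := by ring
  rw [h3, abs_div, abs_two]
  linarith

open DirichletSeries

lemma exists_abs_log_tsum_coeff_sub_le (ψ : AddChar (ZMod 3) ℂ) : ∃ C, ∀ s : ℝ, 1 < s →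
    0 < ∑' n : ℕ, coeff ψ n * (n : ℝ) ^ (-s) ∧
      |Real.log (∑' n : ℕ, coeff ψ n * (n : ℝ) ^ (-s)) -
        ∑' p : Nat.Primes, coeff ψ p * ((p : ℕ) : ℝ) ^ (-s)| ≤ C :=
  exists_abs_log_tsum_sub_le (coeff_zero ψ) (coeff_one ψ) (coeff_mul ψ)
    (abs_coeff_prime_pow_le ψ) (coeff_two_pow ψ) (coeff_three_pow_nonneg ψ)
    fun _ hs ↦ summable_coeff ψ hs

lemma isBigO_log_tsum_coeff_sub (ψ : AddChar (ZMod 3) ℂ) :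
    (fun s : ℝ ↦ Real.log (∑' n : ℕ, coeff ψ n * (n : ℝ) ^ (-s)) -
        ∑' p : Nat.Primes, coeff ψ p * ((p : ℕ) : ℝ) ^ (-s)) =O[𝓝[>] 1] fun _ ↦ (1 : ℝ) := by
  obtain ⟨C, hC⟩ := exists_abs_log_tsum_coeff_sub_le ψ
  refine IsBigO.of_bound C ?_
  filter_upwards [self_mem_nhdsWithin] with s hs
  simpa using (hC s hs).2

lemma isBigO_tsum_coeff_one_primes :
    (fun s : ℝ ↦ ∑' p : Nat.Primes, coeff 1 p * ((p : ℕ) : ℝ) ^ (-s) - -Real.log (s - 1))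
      =O[𝓝[>] 1] fun _ ↦ (1 : ℝ) := by
  obtain ⟨c, C, hc, h⟩ := exists_bounds_tsum_coeff_one
  exact ((isBigO_log_add_log hc h).sub (isBigO_log_tsum_coeff_sub 1)).congr_left fun s ↦ by ring

lemma summable_coeff_primes (ψ : AddChar (ZMod 3) ℂ) {s : ℝ} (hs : 1 < s) :
    Summable fun p : Nat.Primes ↦ coeff ψ p * ((p : ℕ) : ℝ) ^ (-s) :=
  (summable_coeff ψ hs).comp_injective Nat.Primes.coe_nat_injective

lemma coeff_two (ψ : AddChar (ZMod 3) ℂ) : coeff ψ 2 = 1 := by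
  simpa using coeff_two_pow ψ 1

lemma coeff_three (ψ : AddChar (ZMod 3) ℂ) : coeff ψ 3 = 0 := by
  simpa using coeff_three_mul ψ 1

lemma eq_two_or_eq_three_or_five_le {p : ℕ} (hp : p.Prime) : p = 2 ∨ p = 3 ∨ 5 ≤ p := by
  by_contra! h
  have h2 := hp.two_le
  obtain rfl : p = 4 := by omega
  exact absurd hp (by decide)

lemma coeff_combination_nonneg {p : ℕ} (hp : p.Prime) :
    0 ≤ coeff 1 p + 2 * coeff ZMod.stdAddChar p := by
  classical
  rcases eq_two_or_eq_three_or_five_le hp with rfl | rfl | h5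
  · simp only [coeff_two]; norm_num
  · simp only [coeff_three]; norm_num
  · have h := indicator_eq hp h5
    have h0 : (0 : ℝ) ≤ (coeff 1 p + 2 * coeff ZMod.stdAddChar p) / 6 := by
      rw [← h]; split_ifs <;> norm_num
    linarith

lemma stdAddChar_three_ne_one : (ZMod.stdAddChar : AddChar (ZMod 3) ℂ) ≠ 1 := by
  intro h
  have h1 := re_stdAddChar_three (a := 1) one_ne_zero
  rw [h] at h1
  norm_num at h1

/-- The nonvanishing of the `L`-function at `1`, in the form of boundedness of its logarithm. -/
lemma isBigO_log_tsum_coeff :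
    (fun s : ℝ ↦ Real.log (∑' n : ℕ, coeff ZMod.stdAddChar n * (n : ℝ) ^ (-s)))
      =O[𝓝[>] 1] fun _ ↦ (1 : ℝ) := by
  set L : ℝ → ℝ := fun s ↦ ∑' n : ℕ, coeff ZMod.stdAddChar n * (n : ℝ) ^ (-s)
  obtain ⟨l, K, hK⟩ := exists_abs_tsum_coeff_sub_le stdAddChar_three_ne_one
  have hδ : Tendsto (fun s : ℝ ↦ s - 1) (𝓝[>] 1) (𝓝 0) :=
    (Continuous.tendsto' (f := fun s : ℝ ↦ s - 1) (by fun_prop) 1 0 (sub_self 1)).mono_left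
      nhdsWithin_le_nhds
  have hL : Tendsto L (𝓝[>] 1) (𝓝 l) := by
    rw [tendsto_iff_norm_sub_tendsto_zero]
    refine squeeze_zero' (Eventually.of_forall fun _ ↦ norm_nonneg _) hK ?_
    simpa using hδ.const_mul K
  have hl : l ≠ 0 := by
    rintro rfl
    obtain ⟨D, hD⟩ := (isBigO_tsum_coeff_one_primes.sub
      ((isBigO_log_tsum_coeff_sub ZMod.stdAddChar).const_mul_left 2)).bound
    obtain ⟨C, hC⟩ := exists_abs_log_tsum_coeff_sub_le ZMod.stdAddChar
    have hlim : Tendsto (fun s : ℝ ↦ K ^ 2 * (s - 1)) (𝓝[>] 1) (𝓝 0) := by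
      simpa using hδ.const_mul (K ^ 2)
    obtain ⟨s, hD, hK, hlt, hs⟩ := (hD.and (hK.and
      ((hlim.eventually_lt_const (Real.exp_pos (-D))).and self_mem_nhdsWithin))).exists
    have hLpos : 0 < L s := (hC s hs).1
    have hs0 : 0 < s - 1 := by linarith
    have hnonneg : 0 ≤ ∑' p : Nat.Primes, coeff 1 p * ((p : ℕ) : ℝ) ^ (-s) +
        2 * ∑' p : Nat.Primes, coeff ZMod.stdAddChar p * ((p : ℕ) : ℝ) ^ (-s) := by
      rw [← tsum_mul_left, ← (summable_coeff_primes 1 hs).tsum_add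
        ((summable_coeff_primes _ hs).mul_left 2)]
      refine tsum_nonneg fun p ↦ ?_
      rw [← mul_assoc, ← add_mul]
      exact mul_nonneg (coeff_combination_nonneg p.2) (by positivity)
    have hD' := (abs_le.1 (show |_| ≤ D by simpa using hD)).2
    have h1 : Real.log (s - 1) - D ≤ 2 * Real.log (L s) := by
      linarith
    have h2 : (s - 1) * Real.exp (-D) ≤ L s ^ 2 := by
      have := Real.exp_le_exp.2 h1
      rw [sub_eq_add_neg, Real.exp_add, Real.exp_log hs0, two_mul, Real.exp_add,
        Real.exp_log hLpos] at this
      rwa [pow_two]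
    have h3 : L s ^ 2 ≤ (K * (s - 1)) ^ 2 := by
      rw [sub_zero] at hK
      exact pow_le_pow_left₀ hLpos.le ((le_abs_self _).trans hK) 2
    have h4 : (s - 1) * Real.exp (-D) ≤ (s - 1) * (K ^ 2 * (s - 1)) := by
      refine (h2.trans h3).trans_eq ?_; ring
    exact absurd (le_of_mul_le_mul_left h4 hs0) (not_le.2 hlt)
  exact ((Real.continuousAt_log hl).tendsto.comp hL).isBigO_one ℝ

lemma isBigO_tsum_coeff_primes :
    (fun s : ℝ ↦ ∑' p : Nat.Primes, coeff ZMod.stdAddChar p * ((p : ℕ) : ℝ) ^ (-s))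
      =O[𝓝[>] 1] fun _ ↦ (1 : ℝ) :=
  (isBigO_log_tsum_coeff.sub (isBigO_log_tsum_coeff_sub _)).congr_left fun s ↦ by ring

/-- The primes whose density is to be computed. -/
def IsRepresented (p : ℕ) : Prop :=
  ∃ j ∈ ({1, 4, 8} : Set ℤ), ∃ x y : ℤ, Int.gcd x y = 1 ∧ x ^ 2 + 216 * y ^ 2 = j * p

open Classical in
lemma tsum_subtype_prime_and (q : ℕ → Prop) (f : ℕ → ℝ) :
    ∑' p : {p : ℕ // p.Prime ∧ q p}, f p =
      ∑' p : Nat.Primes, (if q p then (1 : ℝ) else 0) * f p := by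
  refine (tsum_subtype {p : ℕ | p.Prime ∧ q p} f).trans (Eq.trans ?_
    (tsum_subtype {p : ℕ | p.Prime} (fun p ↦ (if q p then (1 : ℝ) else 0) * f p)).symm)
  congr 1 with p
  by_cases hp : p.Prime <;> by_cases hq : q p <;> simp [Set.indicator, hp, hq]

open Classical in
lemma isBigO_tsum_represented_sub :
    (fun s : ℝ ↦ ∑' p : {p : ℕ // p.Prime ∧ IsRepresented p}, ((p : ℕ) : ℝ) ^ (-s) -
      (∑' p : Nat.Primes, coeff 1 p * ((p : ℕ) : ℝ) ^ (-s) +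
        2 * ∑' p : Nat.Primes, coeff ZMod.stdAddChar p * ((p : ℕ) : ℝ) ^ (-s)) / 6)
      =O[𝓝[>] 1] fun _ ↦ (1 : ℝ) := by
  have hsum2 : Summable fun p : Nat.Primes ↦ 9 * ((p : ℕ) : ℝ) ^ (-2 : ℝ) :=
    (Nat.Primes.summable_rpow.2 (by norm_num)).mul_left 9
  refine IsBigO.of_bound (∑' p : Nat.Primes, 9 * ((p : ℕ) : ℝ) ^ (-2 : ℝ)) ?_
  filter_upwards [self_mem_nhdsWithin] with s hs
  rw [Set.mem_Ioi] at hs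
  have hind : Summable fun p : Nat.Primes ↦
      (if IsRepresented p then (1 : ℝ) else 0) * ((p : ℕ) : ℝ) ^ (-s) := by
    refine (Nat.Primes.summable_rpow.2 (neg_lt_neg hs)).of_nonneg_of_le (fun p ↦ ?_) fun p ↦ ?_
    · split_ifs <;> positivity
    · have : (0 : ℝ) ≤ ((p : ℕ) : ℝ) ^ (-s) := by positivity
      split_ifs <;> linarith
  have hcomb := (((summable_coeff_primes 1 hs).add
    ((summable_coeff_primes ZMod.stdAddChar hs).mul_left 2)).div_const 6)
  rw [tsum_subtype_prime_and IsRepresented (fun p : ℕ ↦ (p : ℝ) ^ (-s)), ← tsum_mul_left,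
    ← (summable_coeff_primes 1 hs).tsum_add ((summable_coeff_primes _ hs).mul_left 2),
    ← tsum_div_const, ← hind.tsum_sub hcomb, CStarRing.norm_one, mul_one]
  refine tsum_of_norm_bounded hsum2.hasSum fun p ↦ ?_
  have heq : (if IsRepresented p then (1 : ℝ) else 0) * ((p : ℕ) : ℝ) ^ (-s) -
      (coeff 1 p * ((p : ℕ) : ℝ) ^ (-s) + 2 * (coeff ZMod.stdAddChar p * ((p : ℕ) : ℝ) ^ (-s))) / 6 =
      ((if IsRepresented p then (1 : ℝ) else 0) - (coeff 1 p + 2 * coeff ZMod.stdAddChar p) / 6) *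
        ((p : ℕ) : ℝ) ^ (-s) := by ring
  rw [heq, _root_.norm_mul]
  obtain ⟨p, hp⟩ := p
  have hle : ‖(p : ℝ) ^ (-s)‖ ≤ 1 := by
    rw [Real.norm_of_nonneg (by positivity)]
    exact Real.rpow_le_one_of_one_le_of_nonpos (by exact_mod_cast hp.one_le) (by linarith)
  rcases eq_two_or_eq_three_or_five_le hp with rfl | rfl | h5
  · refine (mul_le_of_le_one_right (norm_nonneg _) hle).trans ?_
    simp only [coeff_two]
    split_ifs <;> norm_num [Real.norm_eq_abs, Real.rpow_neg, abs_le]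
  · refine (mul_le_of_le_one_right (norm_nonneg _) hle).trans ?_
    simp only [coeff_three]
    split_ifs <;> norm_num [Real.norm_eq_abs, Real.rpow_neg, abs_le]
  · have h := indicator_eq hp h5
    have h' : (if IsRepresented p then (1 : ℝ) else 0) =
      (coeff 1 p + 2 * coeff ZMod.stdAddChar p) / 6 := h
    simp only [h', sub_self, norm_zero, zero_mul]
    positivity

end IdealNumber

theorem stmt11 :
    Filter.Tendsto (fun s : ℝ =>
      (∑' p : {p : ℕ // p.Prime ∧ ∃ j ∈ ({1, 4, 8} : Set ℤ), ∃ x y : ℤ,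
          Int.gcd x y = 1 ∧ x ^ 2 + 216 * y ^ 2 = j * p}, ((p : ℕ) : ℝ) ^ (-s)) /
      (∑' p : {p : ℕ // p.Prime}, ((p : ℕ) : ℝ) ^ (-s)))
      (nhdsWithin 1 (Set.Ioi 1)) (nhds (1 / 6)) := by
  refine DirichletSeries.tendsto_div_of_isBigO DirichletSeries.tendsto_neg_log_sub_one
    DirichletSeries.isBigO_tsum_primes ?_
  refine ((IdealNumber.isBigO_tsum_represented_sub.add
    (IdealNumber.isBigO_tsum_coeff_one_primes.const_mul_left (1 / 6))).add
    (IdealNumber.isBigO_tsum_coeff_primes.const_mul_left (1 / 3))).congr_left fun s ↦ ?_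
  change _ = ∑' p : {p : ℕ // p.Prime ∧ IdealNumber.IsRepresented p}, ((p : ℕ) : ℝ) ^ (-s) - _
  ring
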